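/- Let 2 ≤ ℓ ≤ p−1 and r = p² − (p−1)ℓ + p. Let f(X) = X^{p²} + f_1X^{p²−1} + ⋯ + f_{p²} be an Eisenstein polynomial of degree p² over K satisfying: v_p(f_p) = 1 and v_p(f_{pi}) ≥ 2 for all i ∈ 𝕀(2,p−1); v_p(f_i) ≥ 2 for all i ∈ 𝕀(1,r−1), v_p(f_r) = 2, and v_p(f_i) ≥ 3 for all i ∈ 𝕀(r+1,p²−1); and −F_p/F_{p²} ∈ (κ_K^×)^{p−1}. Let L = K(π) for a root π of f and let F be the unique degree-p subextension K ⊆ F ⊆ L (which is Galois over K). Then L/F is Galois if and only if ℓ·G_r/(F_p·F_{p²}) ∈ (κ_K^×)^{p−1}. -/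

import Mathlib

open Polynomial IntermediateField

/-- The composite algebra structure `ℤ_[p] → ℚ_[p] → K`. -/
noncomputable instance zpAlgebra (p : ℕ) [Fact (Nat.Prime p)] (K : Type) [Field K]
    [Algebra ℚ_[p] K] : Algebra ℤ_[p] K :=
  ((algebraMap ℚ_[p] K).comp (algebraMap ℤ_[p] ℚ_[p])).toAlgebra

section Nonarchimedean

variable {L : Type*} [NormedField L]

theorem norm_mul_le_pow_add {θ : ℝ} (hθ : 0 ≤ θ) {x y : L} {m n : ℕ}
    (hx : ‖x‖ ≤ θ ^ m) (hy : ‖y‖ ≤ θ ^ n) : ‖x * y‖ ≤ θ ^ (m + n) := by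
  rw [norm_mul, pow_add]
  exact mul_le_mul hx hy (norm_nonneg _) (pow_nonneg hθ _)

variable [IsUltrametricDist L]

theorem norm_natCast_le_one (n : ℕ) : ‖(n : L)‖ ≤ 1 :=
  IsUltrametricDist.norm_natCast_le_one L n

theorem norm_natCast_le_of_dvd {m n : ℕ} (h : m ∣ n) : ‖(n : L)‖ ≤ ‖(m : L)‖ := by
  obtain ⟨k, rfl⟩ := h
  rw [Nat.cast_mul, norm_mul]
  exact mul_le_of_le_one_right (norm_nonneg _) (norm_natCast_le_one k)

theorem ultra_norm_sub_le {x y : L} {c : ℝ} (hx : ‖x‖ ≤ c) (hy : ‖y‖ ≤ c) : ‖x - y‖ ≤ c := by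
  rw [sub_eq_add_neg]
  exact (IsUltrametricDist.norm_add_le_max x (-y)).trans (max_le hx (by rwa [norm_neg]))

theorem ultra_norm_add_le {x y : L} {c : ℝ} (hx : ‖x‖ ≤ c) (hy : ‖y‖ ≤ c) : ‖x + y‖ ≤ c :=
  (IsUltrametricDist.norm_add_le_max x y).trans (max_le hx hy)

theorem ultra_norm_add_lt {x y : L} {c : ℝ} (hx : ‖x‖ < c) (hy : ‖y‖ < c) : ‖x + y‖ < c :=
  (IsUltrametricDist.norm_add_le_max x y).trans_lt (max_lt hx hy)

theorem ultra_norm_sub_lt {x y : L} {c : ℝ} (hx : ‖x‖ < c) (hy : ‖y‖ < c) : ‖x - y‖ < c := by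
  rw [sub_eq_add_neg]
  exact (IsUltrametricDist.norm_add_le_max x (-y)).trans_lt (max_lt hx (by rwa [norm_neg]))

theorem ultra_norm_sum_le {ι : Type*} (S : Finset ι) (t : ι → L) {c : ℝ} (hc : 0 ≤ c)
    (h : ∀ i ∈ S, ‖t i‖ ≤ c) : ‖∑ i ∈ S, t i‖ ≤ c :=
  IsUltrametricDist.norm_sum_le_of_forall_le_of_nonneg hc h

/-- A sum differs from one of its terms by at most the largest of the others. -/
theorem norm_sum_sub_le {ι : Type*} {S : Finset ι} {t : ι → L} {c : ℝ} (hc : 0 ≤ c) {i : ι}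
    (hi : i ∈ S) (h : ∀ j ∈ S, j ≠ i → ‖t j‖ ≤ c) : ‖∑ j ∈ S, t j - t i‖ ≤ c := by
  classical
  rw [← Finset.add_sum_erase _ _ hi, add_sub_cancel_left]
  exact ultra_norm_sum_le _ _ hc fun j hj =>
    h j (Finset.mem_of_mem_erase hj) (Finset.ne_of_mem_erase hj)

theorem norm_eq_of_norm_sub_lt {x y : L} (h : ‖x - y‖ < ‖y‖) : ‖x‖ = ‖y‖ := by
  by_contra hne
  have := IsUltrametricDist.norm_add_eq_max_of_norm_ne_norm (x := x) (y := -y)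
    (by rwa [norm_neg])
  rw [← sub_eq_add_neg, norm_neg] at this
  exact absurd (le_max_right ‖x‖ ‖y‖) (by rw [← this]; exact not_le.2 h)

theorem norm_natCast_eq_one_of_coprime {p n : ℕ} (hp : ‖(p : L)‖ < 1) (h : Nat.Coprime n p) :
    ‖(n : L)‖ = 1 := by
  refine le_antisymm (norm_natCast_le_one n) (not_lt.1 fun hn => ?_)
  have hb := Nat.gcd_eq_gcd_ab n p
  rw [h] at hb
  have hb' : (1 : L) = n * (Nat.gcdA n p : L) + p * (Nat.gcdB n p : L) := by
    simpa using congrArg (Int.cast : ℤ → L) hb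
  have h1 : ‖(n : L) * (Nat.gcdA n p : L)‖ < 1 := by
    rw [norm_mul]
    exact (mul_le_of_le_one_right (norm_nonneg _)
      (IsUltrametricDist.norm_intCast_le_one L _)).trans_lt hn
  have h2 : ‖(p : L) * (Nat.gcdB n p : L)‖ < 1 := by
    rw [norm_mul]
    exact (mul_le_of_le_one_right (norm_nonneg _)
      (IsUltrametricDist.norm_intCast_le_one L _)).trans_lt hp
  have := ultra_norm_add_lt h1 h2
  rw [← hb', norm_one] at this
  exact lt_irrefl _ this

end Nonarchimedean

section TaylorCoefficients

variable {L : Type*} [Field L]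

/-- The coefficients of `∑ k ≤ n, e k * (π * (1 + Z)) ^ k` as a polynomial in `Z`. -/
def ramCoeff (e : ℕ → L) (π : L) (n j : ℕ) : L :=
  ∑ k ∈ Finset.range (n + 1), e k * (k.choose j : L) * π ^ k

theorem sum_ramCoeff_mul_pow (e : ℕ → L) (π z : L) (n : ℕ) :
    ∑ j ∈ Finset.range (n + 1), ramCoeff e π n j * z ^ j =
      ∑ k ∈ Finset.range (n + 1), e k * (π * (1 + z)) ^ k := by
  simp only [ramCoeff, Finset.sum_mul]
  rw [Finset.sum_comm]
  refine Finset.sum_congr rfl fun k hk => ?_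
  have hk' : k + 1 ≤ n + 1 := by simpa using hk
  rw [mul_pow, add_comm 1 z, add_pow, Finset.mul_sum, Finset.mul_sum]
  rw [← Finset.sum_subset (Finset.range_subset_range.2 hk')]
  · refine Finset.sum_congr rfl fun j _ => ?_
    rw [one_pow]; ring
  · intro j _ hj
    rw [Nat.choose_eq_zero_of_lt (by simpa using hj)]
    simp

theorem ramCoeff_zero (e : ℕ → L) (π : L) (n : ℕ) :
    ramCoeff e π n 0 = ∑ k ∈ Finset.range (n + 1), e k * π ^ k := by
  simp [ramCoeff]

theorem ramCoeff_self {e : ℕ → L} {n : ℕ} (π : L) (he : e n = 1) : ramCoeff e π n n = π ^ n := by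
  rw [ramCoeff, Finset.sum_range_succ, Finset.sum_eq_zero]
  · simp [he]
  · intro k hk
    rw [Nat.choose_eq_zero_of_lt (by simpa using hk)]
    simp

end TaylorCoefficients

theorem Nat.Prime.pow_dvd_choose {p a k j : ℕ} (hp : p.Prime) (hj : ¬ p ∣ j) (hk : p ^ a ∣ k) :
    p ^ a ∣ k.choose j := by
  rcases k with _ | k
  · rcases j with _ | j
    · exact absurd (dvd_zero p) hj
    · simp
  rcases j with _ | j
  · exact absurd (dvd_zero p) hj
  have h : p ^ a ∣ (k + 1).choose (j + 1) * (j + 1) := by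
    rw [← Nat.add_one_mul_choose_eq]
    exact Dvd.dvd.mul_right hk _
  exact (Nat.Coprime.pow_left a ((Nat.Prime.coprime_iff_not_dvd hp).2 hj)).dvd_of_dvd_mul_right h

/-- Size conditions on the coefficients `e k` of a monic polynomial of degree `q`, where `q` is a
multiple of the prime `p`, at an element `π` with `‖p‖ = ‖π‖ ^ q`. -/
structure RamBounds {L : Type*} [NormedField L] (p q s : ℕ) (π : L) (e : ℕ → L) : Prop where
  prime : p.Prime
  sq : q = p ^ 2
  s_pos : 0 < s
  s_lt : s + p + 2 ≤ q
  not_dvd : ¬ p ∣ s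
  pos : 0 < ‖π‖
  lt_one : ‖π‖ < 1
  norm_p : ‖(p : L)‖ = ‖π‖ ^ q
  monic : e q = 1
  norm_le : ∀ k, 0 < k → k < q → k ≠ q - p → ‖e k‖ ≤ ‖π‖ ^ (2 * q)
  norm_le_of_lt : ∀ k, ¬ p ∣ k → k < s → ‖e k‖ ≤ ‖π‖ ^ (3 * q)
  norm_le_tame : ‖e (q - p)‖ ≤ ‖π‖ ^ q

namespace RamBounds

variable {L : Type*} [NormedField L] [IsUltrametricDist L] {p q s : ℕ} {π : L} {e : ℕ → L}

omit [IsUltrametricDist L] in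
theorem pow_le (H : RamBounds p q s π e) {m n : ℕ} (h : m ≤ n) : ‖π‖ ^ n ≤ ‖π‖ ^ m :=
  pow_le_pow_of_le_one H.pos.le H.lt_one.le h

omit [IsUltrametricDist L] in
theorem norm_term_le (H : RamBounds p q s π e) {m n a k j : ℕ} (he : ‖e k‖ ≤ ‖π‖ ^ m)
    (hc : ‖(k.choose j : L)‖ ≤ ‖π‖ ^ n) (h : a ≤ m + n + k) :
    ‖e k * (k.choose j : L) * π ^ k‖ ≤ ‖π‖ ^ a :=
  (norm_mul_le_pow_add H.pos.le (norm_mul_le_pow_add H.pos.le he hc)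
    (norm_pow π k).le).trans (H.pow_le h)

theorem norm_choose_le (H : RamBounds p q s π e) {a k j : ℕ} (h : p ^ a ∣ k.choose j) :
    ‖(k.choose j : L)‖ ≤ ‖π‖ ^ (a * q) := by
  refine (norm_natCast_le_of_dvd h).trans_eq ?_
  rw [Nat.cast_pow, norm_pow, H.norm_p, ← pow_mul, mul_comm]

theorem norm_term_le_of_lt (H : RamBounds p q s π e) {j k : ℕ} (hj : 0 < j) (hjp : j < p)
    (hk : k ≤ q) (hks : k ≠ s) :
    ‖e k * (k.choose j : L) * π ^ k‖ ≤ ‖π‖ ^ (2 * q + s + 1) := by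
  have hs := H.s_lt
  have hs0 := H.s_pos
  have hpj : ¬ p ∣ j := Nat.not_dvd_of_pos_of_lt hj hjp
  rcases Nat.eq_zero_or_pos k with rfl | hk0
  · rw [Nat.choose_eq_zero_of_lt hj]
    simp
  by_cases hpk : p ∣ k
  · rcases hk.eq_or_lt with rfl | hkq
    · refine H.norm_term_le (m := 0) (by simp [H.monic])
        (H.norm_choose_le (a := 2) (H.prime.pow_dvd_choose hpj (by rw [H.sq]))) (by omega)
    have hc := H.norm_choose_le (a := 1) (k := k) (j := j)
      (H.prime.pow_dvd_choose hpj (by simpa using hpk))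
    by_cases hkp : k = q - p
    · refine H.norm_term_le (m := q) (by rw [hkp]; exact H.norm_le_tame) hc (by omega)
    · exact H.norm_term_le (H.norm_le k hk0 hkq hkp) hc (by omega)
  · have hc : ‖(k.choose j : L)‖ ≤ ‖π‖ ^ 0 := by simpa using norm_natCast_le_one _
    have hpq : p ∣ q := by rw [H.sq]; exact dvd_pow_self p two_ne_zero
    rcases lt_or_gt_of_ne hks with h | h
    · exact H.norm_term_le (H.norm_le_of_lt k hpk h) hc (by omega)
    · refine H.norm_term_le (H.norm_le k hk0 (lt_of_le_of_ne hk ?_) ?_) hc (by omega)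
      · rintro rfl; exact hpk hpq
      · rintro rfl; exact hpk (Nat.dvd_sub hpq dvd_rfl)

theorem norm_term_le_of_le (H : RamBounds p q s π e) {j k : ℕ} (hjp : p ≤ j) (hjq : j < q)
    (hk : k ≤ q) (hkp : k ≠ q - p) :
    ‖e k * (k.choose j : L) * π ^ k‖ ≤ ‖π‖ ^ (2 * q - p + 1) := by
  have hp0 := H.prime.two_le
  have hs := H.s_lt
  rcases Nat.eq_zero_or_pos k with rfl | hk0
  · rw [Nat.choose_eq_zero_of_lt (by omega)]
    simp
  rcases hk.eq_or_lt with rfl | hkq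
  · refine H.norm_term_le (m := 0) (by simp [H.monic]) (H.norm_choose_le (a := 1) ?_) (by omega)
    rw [pow_one, H.sq]
    exact H.prime.dvd_choose_pow (by omega) (by have := H.sq; omega)
  · exact H.norm_term_le (n := 0) (H.norm_le k hk0 hkq hkp)
      (by simpa using norm_natCast_le_one _) (by omega)

theorem norm_ramCoeff_sub_le (H : RamBounds p q s π e) {j : ℕ} (hj : 0 < j) (hjp : j < p) :
    ‖ramCoeff e π q j - e s * (s.choose j : L) * π ^ s‖ ≤ ‖π‖ ^ (2 * q + s + 1) := by
  have hs := H.s_lt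
  refine norm_sum_sub_le (pow_nonneg H.pos.le _) (Finset.mem_range.2 (by omega)) fun k hk hks => ?_
  exact H.norm_term_le_of_lt hj hjp (by simpa [Nat.lt_succ_iff] using hk) hks

theorem norm_ramCoeff_sub_le' (H : RamBounds p q s π e) {j : ℕ} (hjp : p ≤ j) (hjq : j < q) :
    ‖ramCoeff e π q j - e (q - p) * ((q - p).choose j : L) * π ^ (q - p)‖ ≤
      ‖π‖ ^ (2 * q - p + 1) := by
  have hs := H.s_lt
  refine norm_sum_sub_le (pow_nonneg H.pos.le _) (Finset.mem_range.2 (by omega)) fun k hk hks => ?_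
  exact H.norm_term_le_of_le hjp hjq (by simpa [Nat.lt_succ_iff] using hk) hks

theorem norm_ramCoeff_le (H : RamBounds p q s π e) {j : ℕ} (hj : 0 < j) (hjp : j < p) :
    ‖ramCoeff e π q j‖ ≤ ‖π‖ ^ (2 * q + s) := by
  have hs := H.s_lt
  have hp0 := H.prime.two_le
  rw [← sub_add_cancel (ramCoeff e π q j) (e s * (s.choose j : L) * π ^ s)]
  refine ultra_norm_add_le ((H.norm_ramCoeff_sub_le hj hjp).trans (H.pow_le (by omega)))
    (H.norm_term_le (n := 0) (H.norm_le s H.s_pos (by omega) (by omega))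
      (by simpa using norm_natCast_le_one _) (by omega))

theorem norm_ramCoeff_le' (H : RamBounds p q s π e) {j : ℕ} (hjp : p ≤ j) (hjq : j < q) :
    ‖ramCoeff e π q j‖ ≤ ‖π‖ ^ (2 * q - p) := by
  have hs := H.s_lt
  rw [← sub_add_cancel (ramCoeff e π q j)
    (e (q - p) * ((q - p).choose j : L) * π ^ (q - p))]
  refine ultra_norm_add_le ((H.norm_ramCoeff_sub_le' hjp hjq).trans (H.pow_le (by omega)))
    (H.norm_term_le (n := 0) H.norm_le_tame
      (by simpa using norm_natCast_le_one _) (by omega))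

omit [IsUltrametricDist L] in
theorem norm_p_lt_one (H : RamBounds p q s π e) : ‖(p : L)‖ < 1 := by
  rw [H.norm_p]
  exact pow_lt_one₀ H.pos.le H.lt_one (by have := H.s_lt; omega)

theorem norm_ramCoeff_one (H : RamBounds p q s π e) (hes : ‖e s‖ = ‖π‖ ^ (2 * q)) :
    ‖ramCoeff e π q 1‖ = ‖π‖ ^ (2 * q + s) := by
  have h : ‖e s * (s.choose 1 : L) * π ^ s‖ = ‖π‖ ^ (2 * q + s) := by
    rw [norm_mul, norm_mul, norm_pow, hes, Nat.choose_one_right,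
      norm_natCast_eq_one_of_coprime H.norm_p_lt_one
        ((Nat.Prime.coprime_iff_not_dvd H.prime).2 H.not_dvd).symm, mul_one, pow_add]
  rw [← h]
  refine norm_eq_of_norm_sub_lt ?_
  rw [h]
  exact (H.norm_ramCoeff_sub_le one_pos H.prime.one_lt).trans_lt
    (pow_lt_pow_right_of_lt_one₀ H.pos H.lt_one (by omega))

omit [IsUltrametricDist L] in
theorem choose_modEq (H : RamBounds p q s π e) : ((q - p).choose p + 1) ≡ 0 [MOD p] := by
  have := Fact.mk H.prime
  have hp := H.prime.pos
  have h := @Choose.choose_modEq_choose_mod_mul_choose_div_nat (q - p) p p _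
  have h1 : q - p = p * (p - 1) := by
    rw [H.sq, Nat.mul_sub, pow_two, mul_one]
  rw [h1, Nat.mul_mod_right, Nat.mod_self, Nat.mul_div_cancel_left _ hp, Nat.div_self hp] at h
  rw [h1]
  refine (h.add_right 1).trans ?_
  simp only [Nat.choose_self, Nat.choose_one_right, one_mul]
  rw [Nat.sub_add_cancel H.prime.one_le]
  simp [Nat.ModEq]

theorem norm_ramCoeff_p (H : RamBounds p q s π e) (het : ‖e (q - p)‖ = ‖π‖ ^ q) :
    ‖ramCoeff e π q p‖ = ‖π‖ ^ (2 * q - p) := by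
  have hs := H.s_lt
  have hcop : Nat.Coprime ((q - p).choose p) p := by
    refine ((Nat.Prime.coprime_iff_not_dvd H.prime).2 fun hd => ?_).symm
    have := (Nat.modEq_zero_iff_dvd.1 H.choose_modEq)
    exact H.prime.one_lt.ne' (Nat.dvd_one.1 ((Nat.dvd_add_right hd).1 this))
  have h : ‖e (q - p) * ((q - p).choose p : L) * π ^ (q - p)‖ = ‖π‖ ^ (2 * q - p) := by
    rw [norm_mul, norm_mul, norm_pow, het,
      norm_natCast_eq_one_of_coprime H.norm_p_lt_one hcop, mul_one, ← pow_add]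
    congr 1; omega
  rw [← h]
  refine norm_eq_of_norm_sub_lt ?_
  rw [h]
  exact (H.norm_ramCoeff_sub_le' le_rfl (by omega)).trans_lt
    (pow_lt_pow_right_of_lt_one₀ H.pos H.lt_one (by omega))

end RamBounds

section Hensel

variable (L : Type*) [NormedField L] [IsUltrametricDist L]

/-- The closed unit ball of an ultrametric field, as a subring. -/
def unitBallSubring : Subring L where
  carrier := {x | ‖x‖ ≤ 1}
  mul_mem' {x y} hx hy := by
    simp only [Set.mem_ofPred_eq] at *
    rw [norm_mul]
    exact mul_le_one₀ hx (norm_nonneg _) hy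
  one_mem' := by simp
  add_mem' hx hy := ultra_norm_add_le hx hy
  zero_mem' := by simp
  neg_mem' := by simp

variable {L}

theorem mem_unitBallSubring {x : L} : x ∈ unitBallSubring L ↔ ‖x‖ ≤ 1 := Iff.rfl

theorem norm_eval_sub_eval_le (P : (unitBallSubring L)[X]) (x y : unitBallSubring L) :
    ‖((P.eval x - P.eval y : unitBallSubring L) : L)‖ ≤ ‖((x : L) - y)‖ := by
  obtain ⟨c, hc⟩ := sub_dvd_eval_sub x y P
  rw [hc, Subring.coe_mul, norm_mul, AddSubgroupClass.coe_sub]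
  exact mul_le_of_le_one_right (norm_nonneg _) c.2

/-- Hensel's lemma for a simple approximate root in a complete ultrametric field. -/
theorem exists_root_of_norm_eval_lt_one [CompleteSpace L] (P : (unitBallSubring L)[X])
    (a : unitBallSubring L) (hP : ‖((P.eval a : unitBallSubring L) : L)‖ < 1)
    (hP' : ‖((P.derivative.eval a : unitBallSubring L) : L)‖ = 1) :
    ∃ y : unitBallSubring L, P.eval y = 0 ∧ ‖(y : L) - a‖ < 1 := by
  set ε : ℝ := ‖((P.eval a : unitBallSubring L) : L)‖ with hε
  set d : L := ((P.derivative.eval a : unitBallSubring L) : L) with hd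
  have hd0 : d ≠ 0 := norm_ne_zero_iff.1 (by rw [hP']; exact one_ne_zero)
  have hdi : ‖d⁻¹‖ = 1 := by rw [norm_inv, hP', inv_one]
  have hε0 : 0 ≤ ε := norm_nonneg _
  let D : Set (unitBallSubring L) := {y | ‖(y : L) - a‖ ≤ ε}
  let T : unitBallSubring L → unitBallSubring L := fun y =>
    ⟨y - (P.eval y : unitBallSubring L) * d⁻¹, ultra_norm_sub_le y.2 (by
      rw [norm_mul, hdi, mul_one]; exact (P.eval y).2)⟩
  have hTT : ∀ y ∈ D, ∀ y' ∈ D, ‖(T y : L) - T y'‖ ≤ ε * ‖(y : L) - y'‖ := by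
    intro y hy y' hy'
    obtain ⟨k, hk⟩ := P.binomExpansion y' (y - y')
    rw [add_sub_cancel] at hk
    have hk' : ((P.eval y : unitBallSubring L) : L) - (P.eval y' : unitBallSubring L) =
        ((P.derivative.eval y' : unitBallSubring L) : L) * (y - y') + k * (y - y') ^ 2 := by
      rw [hk]; push_cast; ring
    have h1 : (T y : L) - T y' =
        (y - y') * (d⁻¹ * ((d - (P.derivative.eval y' : unitBallSubring L)) - k * (y - y'))) := by
      have : (T y : L) - T y' = (y - y') - (((P.eval y : unitBallSubring L) : L) -
        (P.eval y' : unitBallSubring L)) * d⁻¹ := by simp only [T]; ring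
      rw [this, hk']
      field_simp
      ring
    have hyy : ‖(y : L) - y'‖ ≤ ε := by
      have : (y : L) - y' = (y - a) - (y' - a) := by ring
      rw [this]; exact ultra_norm_sub_le hy hy'
    rw [h1, norm_mul, norm_mul, hdi, one_mul, mul_comm]
    refine mul_le_mul_of_nonneg_right (ultra_norm_sub_le ?_ ?_) (norm_nonneg _)
    · have := norm_eval_sub_eval_le P.derivative a y'
      rw [AddSubgroupClass.coe_sub] at this
      refine this.trans ?_
      rw [norm_sub_rev]; exact hy'
    · rw [norm_mul]
      exact (mul_le_of_le_one_left (norm_nonneg _) k.2).trans hyy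
  have haD : a ∈ D := by simpa [D] using hε0
  have hTa : ‖(T a : L) - a‖ = ε := by
    have : (T a : L) - a = -((P.eval a : unitBallSubring L) * d⁻¹) := by simp only [T]; ring
    rw [this, norm_neg, norm_mul, hdi, mul_one]
  have hmaps : Set.MapsTo T D D := by
    intro y hy
    have h2 : (T y : L) - a = (T y - T a) + (T a - a) := by ring
    change ‖(T y : L) - a‖ ≤ ε
    rw [h2]
    refine ultra_norm_add_le ((hTT y hy a haD).trans ?_) hTa.le
    exact (mul_le_of_le_one_left (norm_nonneg _) hP.le).trans hy
  have hclosed : IsClosed ((unitBallSubring L : Set L)) := by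
    have : (unitBallSubring L : Set L) = Metric.closedBall 0 1 := by
      ext x
      simp only [SetLike.mem_coe, mem_unitBallSubring, mem_closedBall_zero_iff]
    rw [this]; exact Metric.isClosed_closedBall
  have : CompleteSpace (unitBallSubring L) := hclosed.completeSpace_coe
  have hDc : IsComplete D := by
    refine IsClosed.isComplete ?_
    exact isClosed_le (by fun_prop) continuous_const
  have hcontr : ContractingWith ⟨ε, hε0⟩ (hmaps.restrict T D D) := by
    refine ⟨by exact_mod_cast hP, LipschitzWith.of_dist_le_mul fun y y' => ?_⟩
    have := hTT y y.2 y' y'.2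
    rw [← dist_eq_norm, ← dist_eq_norm] at this
    exact this
  obtain ⟨y, hyD, hy, -⟩ := hcontr.exists_fixedPoint' hDc hmaps haD (edist_ne_top _ _)
  refine ⟨y, ?_, lt_of_le_of_lt hyD hP⟩
  have h3 : (T y : L) = y := congrArg Subtype.val hy
  simp only [T, sub_eq_self, mul_eq_zero, inv_eq_zero, hd0, or_false] at h3
  exact_mod_cast h3

end Hensel

namespace RamBounds

variable {L : Type*} [NormedField L] [IsUltrametricDist L] {p q s ℓ : ℕ} {π : L} {e : ℕ → L}

theorem norm_ramCoeff_mul_pow_le (H : RamBounds p q s π e) (h0 : ramCoeff e π q 0 = 0) {E m : ℕ}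
    {z : L} (hz : ‖z‖ ≤ ‖π‖ ^ m) {j : ℕ} (hj : j ≤ q) (h1 : 0 < j → j < p → E ≤ 2 * q + s + m * j)
    (h2 : p ≤ j → j < q → E ≤ 2 * q - p + m * j) (h3 : j = q → E ≤ q + m * q) :
    ‖ramCoeff e π q j * z ^ j‖ ≤ ‖π‖ ^ E := by
  have hzj : ‖z ^ j‖ ≤ ‖π‖ ^ (m * j) := by
    rw [norm_pow, pow_mul]
    exact pow_le_pow_left₀ (norm_nonneg _) hz _
  rcases Nat.eq_zero_or_pos j with rfl | hj0
  · rw [h0, zero_mul, norm_zero]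
    exact pow_nonneg H.pos.le _
  rcases lt_or_ge j p with hjp | hjp
  · exact (norm_mul_le_pow_add H.pos.le (H.norm_ramCoeff_le hj0 hjp) hzj).trans
      (H.pow_le (h1 hj0 hjp))
  rcases hj.lt_or_eq with hjq | rfl
  · exact (norm_mul_le_pow_add H.pos.le (H.norm_ramCoeff_le' hjp hjq) hzj).trans
      (H.pow_le (h2 hjp hjq))
  · rw [ramCoeff_self π H.monic]
    exact (norm_mul_le_pow_add H.pos.le (norm_pow π j).le hzj).trans (H.pow_le (h3 rfl))

theorem false_of_dominant (H : RamBounds p q s π e) {z : L} {E i : ℕ} (hi : i ≤ q)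
    (hsum : ∑ j ∈ Finset.range (q + 1), ramCoeff e π q j * z ^ j = 0)
    (hE : ‖ramCoeff e π q i * z ^ i‖ = ‖π‖ ^ E)
    (h : ∀ j ≤ q, j ≠ i → ‖ramCoeff e π q j * z ^ j‖ ≤ ‖π‖ ^ (E + 1)) : False := by
  have := norm_sum_sub_le (S := Finset.range (q + 1))
    (t := fun j => ramCoeff e π q j * z ^ j) (pow_nonneg H.pos.le (E + 1))
    (Finset.mem_range.2 (Nat.lt_succ_of_le hi))
    (fun j hj hji => h j (Nat.le_of_lt_succ (Finset.mem_range.1 hj)) hji)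
  rw [hsum, zero_sub, norm_neg, hE] at this
  exact absurd this (not_le.2 (pow_lt_pow_right_of_lt_one₀ H.pos H.lt_one (Nat.lt_succ_self E)))

/-- The slopes of the ramification polygon are `1` and `ℓ`. -/
theorem eq_one_or_eq (H : RamBounds p q s π e) (hℓ : s + p = (p - 1) * ℓ)
    (hes : ‖e s‖ = ‖π‖ ^ (2 * q)) (het : ‖e (q - p)‖ = ‖π‖ ^ q) (h0 : ramCoeff e π q 0 = 0)
    {z : L} {m : ℕ} (hz : ‖z‖ = ‖π‖ ^ m)
    (hsum : ∑ j ∈ Finset.range (q + 1), ramCoeff e π q j * z ^ j = 0) : m = 1 ∨ m = ℓ := by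
  have hs := H.s_lt
  have hp := H.prime.two_le
  by_contra! hm
  obtain ⟨hm1, hmℓ⟩ := hm
  have hzj : ∀ j, ‖z ^ j‖ = ‖π‖ ^ (m * j) := fun j => by rw [norm_pow, hz, pow_mul]
  have hqp : ∀ n, 2 ≤ n → 2 * q - p + p * n + 1 ≤ q + n * q := by
    intro n hn
    obtain ⟨t, rfl⟩ : ∃ t, q = p + t := ⟨q - p, by omega⟩
    obtain ⟨n, rfl⟩ := Nat.exists_eq_add_of_le hn
    have : t * 0 ≤ t * n := Nat.mul_le_mul_left _ (Nat.zero_le _)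
    rw [show 2 * (p + t) - p = p + 2 * t by omega]
    nlinarith
  rcases Nat.eq_zero_or_pos m with rfl | hm0
  · refine H.false_of_dominant (E := q) le_rfl hsum ?_ fun j hj hjq => ?_
    · rw [norm_mul, hzj, ramCoeff_self π H.monic, norm_pow]; simp
    · refine H.norm_ramCoeff_mul_pow_le h0 hz.le hj ?_ ?_ ?_ <;> intros <;> omega
  rcases lt_or_gt_of_ne hmℓ with hlt | hlt
  · refine H.false_of_dominant (E := 2 * q - p + m * p) (i := p) (by omega) hsum ?_
      fun j hj hjp => ?_
    · rw [norm_mul, hzj, H.norm_ramCoeff_p het, pow_add]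
    · refine H.norm_ramCoeff_mul_pow_le h0 hz.le hj (fun hj0 hjp' => ?_) (fun hjp' hjq => ?_)
        (fun hjq => ?_)
      · have h1 : (p - 1) * (m + 1) ≤ (p - 1) * ℓ := Nat.mul_le_mul_left _ hlt
        have h2 : m * 1 ≤ m * j := Nat.mul_le_mul_left _ hj0
        have h3 : (p - 1) * (m + 1) = m * p - m + (p - 1) := by
          rw [Nat.mul_add, Nat.sub_mul, mul_comm p m]; omega
        have h4 : m * 1 ≤ m * p := Nat.mul_le_mul_left _ (by omega)
        omega
      · have h2 : m * (p + 1) ≤ m * j := Nat.mul_le_mul_left _ (by omega)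
        have h3 : m * (p + 1) = m * p + m := by ring
        omega
      · have := hqp m (by omega)
        rw [mul_comm p m] at this
        omega
  · have h1 : (p - 1) * (ℓ + 1) ≤ (p - 1) * m := Nat.mul_le_mul_left _ hlt
    have h3 : (p - 1) * m = m * p - m := by rw [Nat.sub_mul, mul_comm p m, one_mul]
    have h4 : m * 1 ≤ m * p := Nat.mul_le_mul_left _ (by omega)
    rw [Nat.mul_add, mul_one, ← hℓ] at h1
    refine H.false_of_dominant (E := 2 * q + s + m * 1) (i := 1) (by omega) hsum ?_
      fun j hj hj1 => ?_
    · rw [norm_mul, hzj, H.norm_ramCoeff_one hes, ← pow_add]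
    · refine H.norm_ramCoeff_mul_pow_le h0 hz.le hj (fun hj0 hjp' => ?_) (fun hjp' hjq => ?_)
        (fun hjq => ?_)
      · have h2 : m * 2 ≤ m * j := Nat.mul_le_mul_left _ (by omega)
        omega
      · have h2 : m * p ≤ m * j := Nat.mul_le_mul_left _ (by omega)
        omega
      · have := hqp m (by omega)
        rw [mul_comm p m] at this
        omega

/-- Along the slope `ℓ`, only the terms of degree `1` and `p` matter. -/
theorem norm_ramCoeff_mul_pow_le_of_ne (H : RamBounds p q s π e) (hℓ : s + p = (p - 1) * ℓ)
    (hℓ2 : 2 ≤ ℓ) (h0 : ramCoeff e π q 0 = 0) {z : L} (hz : ‖z‖ ≤ ‖π‖ ^ ℓ) {j : ℕ} (hj : j ≤ q)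
    (hj1 : j ≠ 1) (hjp : j ≠ p) :
    ‖ramCoeff e π q j * z ^ j‖ ≤ ‖π‖ ^ (2 * q + s + ℓ + 1) := by
  have hs := H.s_lt
  have hp := H.prime.two_le
  have h3 : (p - 1) * ℓ = ℓ * p - ℓ := by rw [Nat.sub_mul, mul_comm p ℓ, one_mul]
  have h4 : ℓ * 1 ≤ ℓ * p := Nat.mul_le_mul_left _ (by omega)
  refine H.norm_ramCoeff_mul_pow_le h0 hz hj (fun hj0 hjp' => ?_) (fun hjp' hjq => ?_)
        (fun hjq => ?_)
  · have h2 : ℓ * 2 ≤ ℓ * j := Nat.mul_le_mul_left _ (by omega)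
    omega
  · have h2 : ℓ * (p + 1) ≤ ℓ * j := Nat.mul_le_mul_left _ (by omega)
    have h3 : ℓ * (p + 1) = ℓ * p + ℓ := by ring
    omega
  · have : 2 * q - p + p * ℓ + 1 ≤ q + ℓ * q := by
      obtain ⟨t, rfl⟩ : ∃ t, q = p + t := ⟨q - p, by omega⟩
      obtain ⟨n, rfl⟩ := Nat.exists_eq_add_of_le hℓ2
      have : t * 0 ≤ t * n := Nat.mul_le_mul_left _ (Nat.zero_le _)
      rw [show 2 * (p + t) - p = p + 2 * t by omega]
      nlinarith
    rw [mul_comm p ℓ] at this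
    omega

end RamBounds

section Residue

variable {L : Type*} [NormedField L] [IsUltrametricDist L] {O : Type*} [CommRing O] {κ : Type*}
  [Field κ]

/-- `x` lies in the closed unit ball and reduces to `t`, where the residue field is presented
as a quotient `ρ` of a ring `O` of integral representatives. -/
def HasResidue (ι : O →+* L) (ρ : O →+* κ) (x : L) (t : κ) : Prop :=
  ∃ o : O, ‖x - ι o‖ < 1 ∧ ρ o = t

/-- `ι` maps `O` to the closed unit ball, and `ker ρ` is the preimage of the open one. -/
structure IsReduction (ι : O →+* L) (ρ : O →+* κ) : Prop where
  norm_le : ∀ o, ‖ι o‖ ≤ 1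
  norm_lt_iff : ∀ o, ‖ι o‖ < 1 ↔ ρ o = 0

namespace HasResidue

variable {ι : O →+* L} {ρ : O →+* κ} {x y : L} {t u : κ}

omit [IsUltrametricDist L] in
theorem coe (ι : O →+* L) (ρ : O →+* κ) (o : O) : HasResidue ι ρ (ι o) (ρ o) := ⟨o, by simp, rfl⟩

omit [IsUltrametricDist L] in
theorem natCast (ι : O →+* L) (ρ : O →+* κ) (n : ℕ) : HasResidue ι ρ (n : L) (n : κ) := by
  simpa using coe ι ρ (n : O)

theorem add (hx : HasResidue ι ρ x t) (hy : HasResidue ι ρ y u) :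
    HasResidue ι ρ (x + y) (t + u) := by
  obtain ⟨o, ho, rfl⟩ := hx
  obtain ⟨o', ho', rfl⟩ := hy
  refine ⟨o + o', ?_, map_add _ _ _⟩
  rw [map_add, add_sub_add_comm]
  exact ultra_norm_add_lt ho ho'

theorem norm_le (h : IsReduction ι ρ) (hx : HasResidue ι ρ x t) : ‖x‖ ≤ 1 := by
  obtain ⟨o, ho, rfl⟩ := hx
  rw [← sub_add_cancel x (ι o)]
  exact ultra_norm_add_le ho.le (h.norm_le o)

theorem mul (h : IsReduction ι ρ) (hx : HasResidue ι ρ x t) (hy : HasResidue ι ρ y u) :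
    HasResidue ι ρ (x * y) (t * u) := by
  have hy1 := hy.norm_le h
  obtain ⟨o, ho, rfl⟩ := hx
  obtain ⟨o', ho', rfl⟩ := hy
  refine ⟨o * o', ?_, map_mul _ _ _⟩
  have : x * y - ι (o * o') = (x - ι o) * y + ι o * (y - ι o') := by rw [map_mul]; ring
  rw [this]
  refine ultra_norm_add_lt ?_ ?_
  · rw [norm_mul]
    exact (mul_le_of_le_one_right (norm_nonneg _) hy1).trans_lt ho
  · rw [norm_mul]
    exact (mul_le_of_le_one_left (norm_nonneg _) (h.norm_le o)).trans_lt ho'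

theorem pow (h : IsReduction ι ρ) (hx : HasResidue ι ρ x t) (n : ℕ) :
    HasResidue ι ρ (x ^ n) (t ^ n) := by
  induction n with
  | zero => simpa using coe ι ρ 1
  | succ n ih => simpa only [pow_succ] using ih.mul h hx

omit [IsUltrametricDist L] in
theorem zero (hx : ‖x‖ < 1) : HasResidue ι ρ x 0 := ⟨0, by simpa, map_zero _⟩

theorem of_sub (hx : HasResidue ι ρ x t) (hy : ‖y - x‖ < 1) : HasResidue ι ρ y t := by
  simpa using (zero hy).add hx

theorem norm_lt_one (h : IsReduction ι ρ) (hx : HasResidue ι ρ x 0) : ‖x‖ < 1 := by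
  obtain ⟨o, ho, ho0⟩ := hx
  rw [← sub_add_cancel x (ι o)]
  exact ultra_norm_add_lt ho ((h.norm_lt_iff o).2 ho0)

theorem eq_zero (h : IsReduction ι ρ) (hx : HasResidue ι ρ x t) (hx1 : ‖x‖ < 1) : t = 0 := by
  obtain ⟨o, ho, rfl⟩ := hx
  rw [← h.norm_lt_iff, ← sub_sub_cancel x (ι o)]
  exact ultra_norm_sub_lt hx1 ho

theorem norm_eq_one (h : IsReduction ι ρ) (hx : HasResidue ι ρ x t) (ht : t ≠ 0) : ‖x‖ = 1 :=
  (hx.norm_le h).antisymm (not_lt.1 fun hlt => ht (hx.eq_zero h hlt))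

end HasResidue

end Residue

namespace RamBounds

variable {L : Type*} [NormedField L] [IsUltrametricDist L] {p q s ℓ : ℕ} {π : L} {e : ℕ → L}
  {O : Type*} [CommRing O] {κ : Type*} [Field κ] [CharP κ p] {ι : O →+* L} {ρ : O →+* κ}

theorem hasResidue_sum (H : RamBounds p q s π e) (hℓ : s + p = (p - 1) * ℓ) (hℓ2 : 2 ≤ ℓ)
    (h0 : ramCoeff e π q 0 = 0) (hι : IsReduction ι ρ) {g a : O} (hes : e s = p ^ 2 * ι g)
    (het : e (q - p) = p * ι a) {υ t : κ} (hυ : HasResidue ι ρ ((p : L) / π ^ q) υ) {y : L}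
    (hy : HasResidue ι ρ y t) :
    HasResidue ι ρ ((∑ j ∈ Finset.range (q + 1), ramCoeff e π q j * (π ^ ℓ * y) ^ j) /
      π ^ (2 * q + s + ℓ)) (-((ℓ : κ) * ρ g * υ ^ 2 * t) - ρ a * υ * t ^ p) := by
  have hs := H.s_lt
  have hp := H.prime.two_le
  have h3 : (p - 1) * ℓ = ℓ * p - ℓ := by rw [Nat.sub_mul, mul_comm p ℓ, one_mul]
  have h4 : ℓ * 1 ≤ ℓ * p := Nat.mul_le_mul_left _ (by omega)
  have hpκ : (p : κ) = 0 := CharP.cast_eq_zero κ p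
  have hsκ : (s : κ) = -ℓ := by
    have := congrArg (Nat.cast : ℕ → κ) hℓ
    rw [Nat.cast_add, Nat.cast_mul, Nat.cast_sub H.prime.one_le, hpκ] at this
    simpa using this
  have hCκ : (((q - p).choose p : ℕ) : κ) = -1 := by
    have := (CharP.cast_eq_zero_iff κ p _).2 (Nat.modEq_zero_iff_dvd.1 H.choose_modEq)
    rw [Nat.cast_add, Nat.cast_one] at this
    exact eq_neg_of_add_eq_zero_left this
  have hπ0 : π ≠ 0 := norm_pos_iff.1 H.pos
  have hy1 := hy.norm_le hι
  have hz : ‖π ^ ℓ * y‖ ≤ ‖π‖ ^ ℓ := by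
    rw [norm_mul, norm_pow]
    exact mul_le_of_le_one_right (pow_nonneg H.pos.le _) hy1
  set M := 2 * q + s + ℓ with hM
  have hzj : ∀ j, ‖(π ^ ℓ * y) ^ j‖ ≤ ‖π‖ ^ (ℓ * j) := fun j => by
    rw [norm_pow, pow_mul]; exact pow_le_pow_left₀ (norm_nonneg _) hz j
  have hmain := ((((HasResidue.natCast ι ρ s).mul hι (.coe ι ρ g)).mul hι (hυ.pow hι 2)).mul hι
    hy).add ((((HasResidue.natCast ι ρ ((q - p).choose p)).mul hι (.coe ι ρ a)).mul hι hυ).mul hι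
    (hy.pow hι p))
  rw [hsκ, hCκ] at hmain
  have hmain' : -((ℓ : κ) * ρ g * υ ^ 2 * t) - ρ a * υ * t ^ p =
      -(ℓ : κ) * ρ g * υ ^ 2 * t + -1 * ρ a * υ * t ^ p := by ring
  rw [hmain']
  refine hmain.of_sub ?_
  have hpM : π ^ M ≠ 0 := pow_ne_zero _ hπ0
  have e1 : (s * ι g * (p / π ^ q) ^ 2 * y) * π ^ M =
      e s * (s.choose 1 : L) * π ^ s * (π ^ ℓ * y) ^ 1 := by
    rw [hes, Nat.choose_one_right, hM]
    field_simp
    ring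
  have e2 : (((q - p).choose p : ℕ) * ι a * (p / π ^ q) * y ^ p) * π ^ M =
      e (q - p) * ((q - p).choose p : L) * π ^ (q - p) * (π ^ ℓ * y) ^ p := by
    rw [het, mul_pow, ← pow_mul, show M = q + (q - p) + ℓ * p by omega]
    field_simp
    ring
  have key : ‖(∑ j ∈ Finset.range (q + 1), ramCoeff e π q j * (π ^ ℓ * y) ^ j) -
      (s * ι g * (p / π ^ q) ^ 2 * y + ((q - p).choose p : ℕ) * ι a * (p / π ^ q) * y ^ p) * π ^ M‖
      ≤ ‖π‖ ^ (M + 1) := by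
    rw [add_mul, e1, e2]
    have hpm : p ∈ (Finset.range (q + 1)).erase 1 :=
      Finset.mem_erase.2 ⟨by omega, Finset.mem_range.2 (by omega)⟩
    rw [← Finset.add_sum_erase (Finset.range (q + 1)) _ (Finset.mem_range.2 (by omega : 1 < q + 1)),
      ← Finset.add_sum_erase _ _ hpm]
    have : ∀ A B C E F z w : L, A * z + (B * w + C) - (E * z + F * w) =
        (A - E) * z + ((B - F) * w + C) := by intros; ring
    rw [this (ramCoeff e π q 1) (ramCoeff e π q p)]
    refine ultra_norm_add_le ?_ (ultra_norm_add_le ?_ ?_)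
    · exact (norm_mul_le_pow_add H.pos.le (H.norm_ramCoeff_sub_le one_pos H.prime.one_lt)
        (hzj 1)).trans (H.pow_le (by omega))
    · exact (norm_mul_le_pow_add H.pos.le (H.norm_ramCoeff_sub_le' le_rfl (by omega))
        (hzj p)).trans (H.pow_le (by omega))
    · refine ultra_norm_sum_le _ _ (pow_nonneg H.pos.le _) fun j hj => ?_
      simp only [Finset.mem_erase, Finset.mem_range] at hj
      exact H.norm_ramCoeff_mul_pow_le_of_ne hℓ hℓ2 h0 hz (by omega) hj.2.1 hj.1
  have hdiv : ∀ A B : L, A / π ^ M - B = (A - B * π ^ M) / π ^ M := by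
    intros; field_simp
  rw [hdiv, norm_div, norm_pow, div_lt_one (pow_pos H.pos _)]
  exact key.trans_lt (pow_lt_pow_right_of_lt_one₀ H.pos H.lt_one (Nat.lt_succ_self M))

/-- A root with `‖z‖ = ‖π‖ ^ ℓ` gives a root of the residual polynomial. -/
theorem exists_residual_root (H : RamBounds p q s π e) (hℓ : s + p = (p - 1) * ℓ) (hℓ2 : 2 ≤ ℓ)
    (h0 : ramCoeff e π q 0 = 0) (hι : IsReduction ι ρ) {g a b : O} (hes : e s = p ^ 2 * ι g)
    (het : e (q - p) = p * ι a) {υ : κ} (hυ : HasResidue ι ρ ((p : L) / π ^ q) υ)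
    (hυb : υ * ρ b = -1) (ha : ρ a ≠ 0)
    (hres : ∀ y : L, ‖y‖ = 1 → ∃ t, HasResidue ι ρ y t) {z : L} (hz : ‖z‖ = ‖π‖ ^ ℓ)
    (hsum : ∑ j ∈ Finset.range (q + 1), ramCoeff e π q j * z ^ j = 0) :
    ∃ c : κ, c ≠ 0 ∧ c ^ (p - 1) = (ℓ : κ) * ρ g / (ρ a * ρ b) := by
  have hπ0 : π ≠ 0 := norm_pos_iff.1 H.pos
  have hb : ρ b ≠ 0 := fun h => by simp [h] at hυb
  have hzy : π ^ ℓ * (z / π ^ ℓ) = z := by field_simp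
  have hy : ‖z / π ^ ℓ‖ = 1 := by
    rw [norm_div, norm_pow, hz, div_self (pow_ne_zero _ H.pos.ne')]
  obtain ⟨t, ht⟩ := hres _ hy
  have ht0 : t ≠ 0 := by
    rintro rfl
    exact (ht.norm_lt_one hι).ne hy
  have h := H.hasResidue_sum hℓ hℓ2 h0 hι hes het hυ ht
  rw [hzy, hsum, zero_div] at h
  have h := h.eq_zero hι (by simp)
  refine ⟨t, ht0, ?_⟩
  have hυ' : υ = -1 / ρ b := by field_simp; exact hυb
  obtain ⟨n, hn⟩ : ∃ n, p = n + 1 := ⟨p - 1, by have := H.prime.pos; omega⟩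
  rw [hn, Nat.add_sub_cancel]
  rw [hn, hυ', pow_succ] at h
  field_simp at h ⊢
  have h' : t * (t ^ n * ρ a * ρ b - ℓ * ρ g) = 0 := by linear_combination h
  have := (mul_eq_zero.1 h').resolve_left ht0
  linear_combination this

/-- A root of the residual polynomial lifts to a root with `‖z‖ = ‖π‖ ^ ℓ`. -/
theorem exists_root_of_residual_root [CompleteSpace L] (H : RamBounds p q s π e)
    (hℓ : s + p = (p - 1) * ℓ) (hℓ2 : 2 ≤ ℓ)
    (h0 : ramCoeff e π q 0 = 0) (hι : IsReduction ι ρ) (hρ : Function.Surjective ρ)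
    {g a b : O} (hes : e s = p ^ 2 * ι g) (hg : ‖ι g‖ = 1)
    (het : e (q - p) = p * ι a) {υ : κ} (hυ : HasResidue ι ρ ((p : L) / π ^ q) υ)
    (hυb : υ * ρ b = -1) (ha : ρ a ≠ 0) {c : κ} (hc0 : c ≠ 0)
    (hc : c ^ (p - 1) = (ℓ : κ) * ρ g / (ρ a * ρ b)) :
    ∃ z : L, z ≠ 0 ∧ ∑ j ∈ Finset.range (q + 1), ramCoeff e π q j * z ^ j = 0 := by
  have hs := H.s_lt
  have hp := H.prime.two_le
  have hπ0 : π ≠ 0 := norm_pos_iff.1 H.pos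
  have hb : ρ b ≠ 0 := fun h => by simp [h] at hυb
  set M := 2 * q + s + ℓ with hM
  have hpM : π ^ M ≠ 0 := pow_ne_zero _ hπ0
  have h3 : (p - 1) * ℓ = ℓ * p - ℓ := by rw [Nat.sub_mul, mul_comm p ℓ, one_mul]
  have h4 : ℓ * 1 ≤ ℓ * p := Nat.mul_le_mul_left _ (by omega)
  have hes1 : ‖e s‖ = ‖π‖ ^ (2 * q) := by
    rw [hes, norm_mul, hg, norm_pow, H.norm_p, mul_one, ← pow_mul, mul_comm]
  obtain ⟨o, rfl⟩ := hρ c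
  let B : ℕ → L := fun j => ramCoeff e π q j * (π ^ ℓ) ^ j / π ^ M
  have hB : ∀ j ≤ q, j ≠ 1 → j ≠ p → ‖B j‖ ≤ ‖π‖ := by
    intro j hj hj1 hjp
    have := H.norm_ramCoeff_mul_pow_le_of_ne hℓ hℓ2 h0 (z := π ^ ℓ) (norm_pow _ _).le hj hj1 hjp
    simp only [B]
    rw [norm_div, norm_pow π M, div_le_iff₀ (pow_pos H.pos _), ← pow_succ']
    exact this
  have hB1 : ‖B 1‖ = 1 := by
    simp only [B]
    rw [norm_div, norm_mul, H.norm_ramCoeff_one hes1, pow_one, norm_pow, norm_pow, ← pow_add,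
      div_self (pow_ne_zero _ H.pos.ne')]
  have hBp : ‖B p‖ ≤ 1 := by
    simp only [B]
    rw [norm_div, norm_pow π M, div_le_one (pow_pos H.pos _)]
    refine (norm_mul_le_pow_add H.pos.le (H.norm_ramCoeff_le' le_rfl (by omega))
      (n := ℓ * p) (by rw [norm_pow, norm_pow, pow_mul])).trans (H.pow_le (by omega))
  have hBall : ∀ j, ‖(if j ≤ q then B j else 0)‖ ≤ 1 := by
    intro j
    split_ifs with hj
    · by_cases hj1 : j = 1
      · rw [hj1, hB1]
      by_cases hjp : j = p
      · rw [hjp]; exact hBp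
      exact (hB j hj hj1 hjp).trans H.lt_one.le
    · simp
  let β : ℕ → unitBallSubring L := fun j => ⟨if j ≤ q then B j else 0, hBall j⟩
  let P : (unitBallSubring L)[X] := ∑ j ∈ Finset.range (q + 1), C (β j) * X ^ j
  have hPe : ∀ y : unitBallSubring L, ((P.eval y : unitBallSubring L) : L) =
      (∑ j ∈ Finset.range (q + 1), ramCoeff e π q j * (π ^ ℓ * (y : L)) ^ j) / π ^ M := by
    intro y
    simp only [P, eval_finsetSum, eval_mul, eval_C, eval_pow, eval_X]
    rw [Finset.sum_div, AddSubmonoidClass.coe_finsetSum]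
    refine Finset.sum_congr rfl fun j hj => ?_
    have hj' : j ≤ q := Nat.le_of_lt_succ (Finset.mem_range.1 hj)
    simp only [Subring.coe_mul, SubmonoidClass.coe_pow, β, if_pos hj', B]
    rw [mul_pow]; ring
  have hP' : ∀ y : unitBallSubring L, ‖((P.derivative.eval y : unitBallSubring L) : L)‖ = 1 := by
    intro y
    simp only [P, derivative_sum, derivative_C_mul_X_pow, eval_finsetSum, eval_mul, eval_C,
      eval_pow, eval_X]
    rw [AddSubmonoidClass.coe_finsetSum]
    have hle : ∀ j ∈ Finset.range (q + 1), j ≠ 1 →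
        ‖((β j * (j : unitBallSubring L) * y ^ (j - 1) : unitBallSubring L) : L)‖ ≤
          max ‖π‖ ‖(p : L)‖ := by
      intro j hj hj1
      have hj' : j ≤ q := Nat.le_of_lt_succ (Finset.mem_range.1 hj)
      rw [Subring.coe_mul, norm_mul]
      refine (mul_le_of_le_one_right (norm_nonneg _) (y ^ (j - 1)).2).trans ?_
      rw [Subring.coe_mul, norm_mul]
      by_cases hjp : j = p
      · subst hjp
        refine (mul_le_of_le_one_left (norm_nonneg _) (β j).2).trans ?_
        simp
      · refine (mul_le_of_le_one_right (norm_nonneg _) (j : unitBallSubring L).2).trans ?_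
        refine le_max_of_le_left ?_
        simp only [β, if_pos hj']
        exact hB j hj' hj1 hjp
    have h1 : ‖((β 1 * ((1 : ℕ) : unitBallSubring L) * y ^ (1 - 1) : unitBallSubring L) : L)‖
        = 1 := by
      simpa [β, show 1 ≤ q by omega] using hB1
    refine (norm_eq_of_norm_sub_lt ?_).trans h1
    rw [h1]
    exact (norm_sum_sub_le (le_max_of_le_left (norm_nonneg _))
      (Finset.mem_range.2 (by omega)) hle).trans_lt (max_lt H.lt_one H.norm_p_lt_one)
  have hPo : ‖((P.eval ⟨ι o, hι.norm_le o⟩ : unitBallSubring L) : L)‖ < 1 := by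
    rw [hPe]
    refine HasResidue.norm_lt_one hι ?_
    have h := H.hasResidue_sum hℓ hℓ2 h0 hι hes het hυ (.coe ι ρ o)
    convert h using 1
    have hυ' : υ = -1 / ρ b := by field_simp; exact hυb
    obtain ⟨n, hn⟩ : ∃ n, p = n + 1 := ⟨p - 1, by omega⟩
    rw [hn, Nat.add_sub_cancel] at hc
    rw [hn, hυ', pow_succ (ρ o), hc]
    field_simp
    ring
  obtain ⟨y, hy, hyo⟩ := exists_root_of_norm_eval_lt_one P _ hPo (hP' _)
  have hres : HasResidue ι ρ (y : L) (ρ o) := ⟨o, hyo, rfl⟩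
  have hy1 := hres.norm_eq_one hι hc0
  refine ⟨π ^ ℓ * y, mul_ne_zero (pow_ne_zero _ hπ0) (norm_ne_zero_iff.1 (by simp [hy1])), ?_⟩
  have := hPe y
  rw [hy] at this
  simpa [hpM] using this.symm

end RamBounds

section Expansion

variable {K E L : Type*} [Field K] [Field E] [Algebra K E] [NormedField L] [IsUltrametricDist L]
  {φ : E →+* L} {θ : ℝ} {N : ℕ} {ϖ : E}

/-- If the nonzero elements of `K` have norms in `θ ^ (N ℤ)` and `‖ϖ‖ = θ`, then in a
`K`-combination of `1, ϖ, …, ϖ ^ (N - 1)` no cancellation occurs. -/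
theorem exists_norm_sum_eq (hθ0 : 0 < θ) (hθ1 : θ < 1) (hN : 0 < N)
    (hK : ∀ x : K, x ≠ 0 → ∃ m : ℤ, ‖φ (algebraMap K E x)‖ = θ ^ ((N : ℤ) * m))
    (hϖ : ‖φ ϖ‖ = θ) (c : Fin N → K) :
    (∃ i, ‖φ (∑ j, c j • ϖ ^ (j : ℕ))‖ = ‖φ (c i • ϖ ^ (i : ℕ))‖) ∧
      ∀ i, ‖φ (c i • ϖ ^ (i : ℕ))‖ ≤ ‖φ (∑ j, c j • ϖ ^ (j : ℕ))‖ := by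
  have : Nonempty (Fin N) := ⟨⟨0, hN⟩⟩
  obtain ⟨i, hi⟩ := Finite.exists_max fun i : Fin N => ‖φ (c i • ϖ ^ (i : ℕ))‖
  suffices h : ‖φ (∑ j, c j • ϖ ^ (j : ℕ))‖ = ‖φ (c i • ϖ ^ (i : ℕ))‖ from
    ⟨⟨i, h⟩, fun j => (hi j).trans_eq h.symm⟩
  have hval : ∀ j, c j ≠ 0 → ∃ m : ℤ, ‖φ (c j • ϖ ^ (j : ℕ))‖ = θ ^ ((N : ℤ) * m + (j : ℕ)) := by
    intro j hj
    obtain ⟨m, hm⟩ := hK _ hj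
    refine ⟨m, ?_⟩
    rw [Algebra.smul_def, map_mul, norm_mul, hm, map_pow, norm_pow, hϖ, zpow_add₀ hθ0.ne',
      zpow_natCast]
  by_cases hci : c i = 0
  · have hz : ∀ j, φ (c j • ϖ ^ (j : ℕ)) = 0 := by
      intro j
      have := hi j
      rw [hci, zero_smul, map_zero, norm_zero] at this
      exact norm_le_zero_iff.1 this
    rw [map_sum, Finset.sum_congr rfl fun j _ => hz j, hz i]
    simp
  · have hlt : ∀ j, j ≠ i → ‖φ (c j • ϖ ^ (j : ℕ))‖ < ‖φ (c i • ϖ ^ (i : ℕ))‖ := by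
      intro j hji
      refine lt_of_le_of_ne (hi j) fun heq => ?_
      obtain ⟨m, hm⟩ := hval i hci
      by_cases hcj : c j = 0
      · rw [hcj, zero_smul, map_zero, norm_zero, hm] at heq
        exact (zpow_pos hθ0 _).ne heq
      obtain ⟨m', hm'⟩ := hval j hcj
      rw [hm, hm'] at heq
      have heq := (zpow_right_strictAnti₀ hθ0 hθ1).injective heq
      have h1 : ((j : ℕ) : ℤ) = ((i : ℕ) : ℤ) := by
        have := congrArg (· % (N : ℤ)) heq
        simp only [Int.mul_add_emod_self_left] at this
        rwa [Int.emod_eq_of_lt (by positivity) (by exact_mod_cast j.2),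
          Int.emod_eq_of_lt (by positivity) (by exact_mod_cast i.2)] at this
      exact hji (Fin.ext (by exact_mod_cast h1))
    rw [map_sum]
    refine norm_eq_of_norm_sub_lt ?_
    rw [← Finset.add_sum_erase _ _ (Finset.mem_univ i), add_sub_cancel_left]
    rcases ((Finset.univ : Finset (Fin N)).erase i).eq_empty_or_nonempty with he | hne
    · rw [he, Finset.sum_empty, norm_zero, norm_pos_iff, ← norm_pos_iff]
      obtain ⟨m, hm⟩ := hval i hci
      rw [hm]
      exact zpow_pos hθ0 _
    · obtain ⟨j, hj, hj'⟩ := IsUltrametricDist.exists_norm_finsetSum_le_of_nonempty hne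
        (fun j => φ (c j • ϖ ^ (j : ℕ)))
      exact hj'.trans_lt (hlt j (Finset.ne_of_mem_erase hj))

theorem linearIndependent_pow_of_norm (hθ0 : 0 < θ) (hθ1 : θ < 1) (hN : 0 < N)
    (hK : ∀ x : K, x ≠ 0 → ∃ m : ℤ, ‖φ (algebraMap K E x)‖ = θ ^ ((N : ℤ) * m))
    (hϖ : ‖φ ϖ‖ = θ) : LinearIndependent K fun i : Fin N => ϖ ^ (i : ℕ) := by
  rw [Fintype.linearIndependent_iff]
  intro c hc i
  have := (exists_norm_sum_eq hθ0 hθ1 hN hK hϖ c).2 i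
  rw [hc, map_zero, norm_zero, norm_le_zero_iff, map_eq_zero, smul_eq_zero] at this
  refine this.resolve_right (pow_ne_zero _ ?_)
  rintro rfl
  rw [map_zero, norm_zero] at hϖ
  exact hθ0.ne hϖ

theorem exists_expansion (hθ0 : 0 < θ) (hθ1 : θ < 1) (hN : 0 < N)
    (hK : ∀ x : K, x ≠ 0 → ∃ m : ℤ, ‖φ (algebraMap K E x)‖ = θ ^ ((N : ℤ) * m))
    (hϖ : ‖φ ϖ‖ = θ) (hrank : Module.finrank K E = N) (x : E) :
    ∃ c : Fin N → K, x = ∑ j, c j • ϖ ^ (j : ℕ) := by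
  have : Nonempty (Fin N) := ⟨⟨0, hN⟩⟩
  have hli := linearIndependent_pow_of_norm hθ0 hθ1 hN hK hϖ
  let b := basisOfLinearIndependentOfCardEqFinrank hli (by rw [hrank, Fintype.card_fin])
  refine ⟨fun j => b.repr x j, ?_⟩
  conv_lhs => rw [← b.sum_repr x]
  exact Finset.sum_congr rfl fun j _ => by rw [coe_basisOfLinearIndependentOfCardEqFinrank]

theorem norm_coeff_le_one (hθ0 : 0 < θ) (hθ1 : θ < 1) (hN : 0 < N)
    (hK : ∀ x : K, x ≠ 0 → ∃ m : ℤ, ‖φ (algebraMap K E x)‖ = θ ^ ((N : ℤ) * m))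
    (hϖ : ‖φ ϖ‖ = θ) (c : Fin N → K) (hx : ‖φ (∑ j, c j • ϖ ^ (j : ℕ))‖ ≤ 1) (i : Fin N) :
    ‖φ (algebraMap K E (c i))‖ ≤ 1 := by
  by_cases hci : c i = 0
  · simp [hci]
  have h := ((exists_norm_sum_eq hθ0 hθ1 hN hK hϖ c).2 i).trans hx
  obtain ⟨m, hm⟩ := hK _ hci
  rw [Algebra.smul_def, map_mul, norm_mul, hm, map_pow, norm_pow, hϖ, ← zpow_natCast,
    ← zpow_add₀ hθ0.ne', ← zpow_zero θ,
    (zpow_right_strictAnti₀ hθ0 hθ1).le_iff_ge] at h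
  rw [hm, ← zpow_zero θ, (zpow_right_strictAnti₀ hθ0 hθ1).le_iff_ge]
  have hi : ((i : ℕ) : ℤ) < N := by exact_mod_cast i.2
  have hm0 : -1 < m := by
    by_contra! hcon
    have : (N : ℤ) * m ≤ N * (-1) := mul_le_mul_of_nonneg_left hcon (by positivity)
    omega
  exact mul_nonneg (by positivity) (by omega)

theorem exists_norm_eq_zpow (hθ0 : 0 < θ) (hθ1 : θ < 1) (hN : 0 < N)
    (hK : ∀ x : K, x ≠ 0 → ∃ m : ℤ, ‖φ (algebraMap K E x)‖ = θ ^ ((N : ℤ) * m))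
    (hϖ : ‖φ ϖ‖ = θ) (hrank : Module.finrank K E = N) {x : E} (hx : x ≠ 0) :
    ∃ m : ℤ, ‖φ x‖ = θ ^ m := by
  obtain ⟨c, rfl⟩ := exists_expansion hθ0 hθ1 hN hK hϖ hrank x
  obtain ⟨i, hi⟩ := (exists_norm_sum_eq hθ0 hθ1 hN hK hϖ c).1
  by_cases hci : c i = 0
  · rw [hci, zero_smul, map_zero, norm_zero, norm_eq_zero, map_eq_zero] at hi
    exact absurd hi hx
  obtain ⟨m, hm⟩ := hK _ hci
  refine ⟨N * m + (i : ℕ), ?_⟩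
  rw [hi, Algebra.smul_def, map_mul, norm_mul, hm, map_pow, norm_pow, hϖ, zpow_add₀ hθ0.ne',
    zpow_natCast]

end Expansion

theorem Polynomial.eval_derivative_prod_of_eval_eq_zero {R ι : Type*} [CommRing R] [DecidableEq ι]
    (S : Finset ι) (P : ι → R[X]) {i : ι} (hi : i ∈ S) {x : R} (hx : (P i).eval x = 0) :
    (∏ j ∈ S, P j).derivative.eval x =
      (P i).derivative.eval x * ∏ j ∈ S.erase i, (P j).eval x := by
  rw [← Finset.mul_prod_erase _ _ hi, derivative_mul, eval_add, eval_mul, eval_mul, hx, zero_mul,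
    add_zero, eval_prod]

section Galois

variable {K L : Type*} [Field K] [Field L] [Algebra K L] [FiniteDimensional K L]

omit [FiniteDimensional K L] in
theorem injective_aut_apply_of_adjoin_eq_top {π : L} (hgen : adjoin K {π} = ⊤) :
    Function.Injective fun σ : L ≃ₐ[K] L => σ π := by
  intro σ σ' h
  have hle : (⊤ : IntermediateField K L) ≤
      (AlgHom.equalizer (σ : L →ₐ[K] L) (σ' : L →ₐ[K] L)).toIntermediateField
        (fun x hx => by
          simp only [AlgHom.mem_equalizer, map_inv₀] at hx ⊢
          rw [hx]) := by
    rw [← hgen, adjoin_le_iff, Set.singleton_subset_iff]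
    exact h
  ext x
  exact hle (mem_top (x := x))

theorem minpoly_map_eq_prod_aut [IsGalois K L] {π : L} (hgen : adjoin K {π} = ⊤) :
    (minpoly K π).map (algebraMap K L) = ∏ σ : L ≃ₐ[K] L, (X - C (σ π)) := by
  classical
  have hint := IsIntegral.of_finite K π
  have hm := (minpoly.monic hint).map (algebraMap K L)
  have hmon : (∏ σ : L ≃ₐ[K] L, (X - C (σ π))).Monic := monic_prod_of_monic _ _ fun σ _ =>
    monic_X_sub_C _
  refine eq_of_monic_of_dvd_of_natDegree_le hmon hm ?_ ?_
  · refine Finset.prod_dvd_of_coprime (fun σ _ σ' _ hne => ?_) fun σ _ => ?_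
    · exact pairwise_coprime_X_sub_C (injective_aut_apply_of_adjoin_eq_top hgen) hne
    · rw [dvd_iff_isRoot, IsRoot.def, eval_map_algebraMap, aeval_algHom_apply,
        minpoly.aeval, map_zero]
  · rw [natDegree_map, natDegree_prod_of_monic _ _ fun σ _ => monic_X_sub_C _]
    simp only [natDegree_X_sub_C, Finset.sum_const, Finset.card_univ, smul_eq_mul, mul_one]
    rw [← Nat.card_eq_fintype_card, IsGalois.card_aut_eq_finrank, ← adjoin.finrank hint, hgen,
      finrank_top']

omit [FiniteDimensional K L] in
theorem minpoly_map_eq_prod_conj {F : IntermediateField K L} [FiniteDimensional K L] [IsGalois K F]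
    {π : L} (hgen : adjoin K {π} = ⊤) (hgenF : adjoin F {π} = ⊤) :
    (minpoly K π).map (algebraMap K F) =
      ∏ τ : F ≃ₐ[K] F, (minpoly F π).map (τ : F →+* F) := by
  classical
  have hint := IsIntegral.of_finite K π
  have hintF := IsIntegral.of_finite F π
  set A : F[X] := ∏ τ : F ≃ₐ[K] F, (minpoly F π).map (τ : F →+* F) with hA
  have hmonF : ∀ τ : F ≃ₐ[K] F, ((minpoly F π).map (τ : F →+* F)).Monic := fun τ =>
    (minpoly.monic hintF).map _
  have hfix : ∀ τ : F ≃ₐ[K] F, A.map (τ : F →+* F) = A := by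
    intro τ
    rw [hA, Polynomial.map_prod]
    refine Fintype.prod_equiv (Equiv.mulLeft τ) _ _ fun τ' => ?_
    rw [Polynomial.map_map]
    rfl
  have hlift : A ∈ lifts (algebraMap K F) := by
    rw [lifts_iff_coeff_lifts]
    intro n
    rw [IsGalois.mem_range_algebraMap_iff_fixed]
    intro τ
    conv_rhs => rw [← hfix τ]
    rw [coeff_map]
    rfl
  have hAmon : A.Monic := monic_prod_of_monic _ _ fun τ _ => hmonF τ
  obtain ⟨B, hBA, hBdeg, hBmon⟩ := lifts_and_natDegree_eq_and_monic hlift hAmon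
  rw [← hBA]
  congr 1
  refine (eq_of_monic_of_dvd_of_natDegree_le (minpoly.monic hint) hBmon
    (minpoly.dvd K π ?_) ?_).symm
  · rw [← aeval_map_algebraMap F, hBA, hA, map_prod]
    refine Finset.prod_eq_zero (Finset.mem_univ (1 : F ≃ₐ[K] F)) ?_
    have : (minpoly F π).map ((1 : F ≃ₐ[K] F) : F →+* F) = minpoly F π := Polynomial.map_id
    rw [this, minpoly.aeval]
  · rw [hBdeg, hA, natDegree_prod_of_monic _ _ fun τ _ => hmonF τ]
    simp only [natDegree_map, Finset.sum_const, Finset.card_univ, smul_eq_mul]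
    rw [← Nat.card_eq_fintype_card, IsGalois.card_aut_eq_finrank, ← adjoin.finrank hintF, hgenF,
      finrank_top', ← adjoin.finrank hint, hgen, finrank_top', Module.finrank_mul_finrank]

/-- A second root of the minimal polynomial of a generator gives a nontrivial automorphism. -/
theorem exists_aut_apply_eq {π π' : L} (hgen : adjoin K {π} = ⊤)
    (h : aeval π' (minpoly K π) = 0) : ∃ σ : L ≃ₐ[K] L, σ π = π' := by
  have hint := IsIntegral.of_finite K π
  have halg : Algebra.adjoin K {π} = ⊤ := by
    rw [← adjoin_simple_toSubalgebra_of_isAlgebraic hint.isAlgebraic, hgen, top_toSubalgebra]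
  let pb := PowerBasis.ofAdjoinEqTop hint halg
  have hpb : pb.gen = π := PowerBasis.ofAdjoinEqTop_gen hint halg
  refine ⟨AlgEquiv.ofBijective (pb.lift π' (by rw [hpb]; exact h))
    (AlgHom.bijective _), ?_⟩
  exact (congrArg _ hpb.symm).trans (pb.lift_gen π' (by rw [hpb]; exact h))

/-- If `[L : K] = p ^ 2` and `L/K` has a nontrivial automorphism, then `L` is Galois over the unique
subextension of degree `p`. -/
theorem isGalois_of_unique_of_aut_ne_one {p : ℕ} (hp : p.Prime)
    (hrank : Module.finrank K L = p ^ 2) {F : IntermediateField K L}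
    (huniq : ∀ F' : IntermediateField K L, Module.finrank K F' = p → F' = F) {σ : L ≃ₐ[K] L}
    (hσ : σ ≠ 1) : IsGalois F L := by
  have := Fact.mk hp
  have hdvd : Nat.card (L ≃ₐ[K] L) ∣ p ^ 2 := by
    have h := finrank_fixedField_eq_card (⊤ : Subgroup (L ≃ₐ[K] L))
    rw [Subgroup.card_top] at h
    rw [← h, ← hrank]
    exact ⟨_, (Module.finrank_mul_finrank K _ L).symm.trans (mul_comm _ _)⟩
  have hcard : p ∣ Nat.card (L ≃ₐ[K] L) := by
    obtain ⟨k, -, hk⟩ := (Nat.dvd_prime_pow hp).1 hdvd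
    rcases k with _ | k
    · rw [pow_zero, Nat.card_eq_one_iff_unique] at hk
      obtain ⟨h, -⟩ := hk
      exact absurd (Subsingleton.elim σ 1) hσ
    · rw [hk]; exact dvd_pow_self p k.succ_ne_zero
  obtain ⟨g, hg⟩ := exists_prime_orderOf_dvd_card' p hcard
  have h1 : Module.finrank (fixedField (Subgroup.zpowers g)) L = p := by
    rw [finrank_fixedField_eq_card, Nat.card_zpowers, hg]
  have h2 : Module.finrank K (fixedField (Subgroup.zpowers g)) = p := by
    have := Module.finrank_mul_finrank K (fixedField (Subgroup.zpowers g)) L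
    rw [h1, hrank, pow_two] at this
    exact Nat.eq_of_mul_eq_mul_right hp.pos this
  rw [← huniq _ h2]
  exact IsGalois.of_fixed_field L (Subgroup.zpowers g)

end Galois

section Different

variable {K L : Type*} [Field K] [NormedField L] [IsUltrametricDist L] [Algebra K L]
  {F : IntermediateField K L} {p : ℕ} {π : L}

/-- In a tower `K ⊆ F ⊆ L` of degrees `p`, `p` with `L/K` totally ramified with uniformizer `π`,
the nonzero elements of `F` have norms in `‖π‖ ^ (p ℤ)`. -/
theorem exists_norm_intermediate_eq_zpow (hp : 0 < p) (hπ0 : 0 < ‖π‖) (hπ1 : ‖π‖ < 1)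
    (hK : ∀ x : K, x ≠ 0 → ∃ m : ℤ, ‖algebraMap K L x‖ = ‖π‖ ^ (((p ^ 2 : ℕ) : ℤ) * m))
    (hrank : Module.finrank K L = p ^ 2) [FiniteDimensional K F] [IsGalois K F]
    (hF : Module.finrank K F = p)
    (hτ : ∀ (τ : F ≃ₐ[K] F) (x : F), ‖algebraMap F L (τ x)‖ = ‖algebraMap F L x‖)
    {x : F} (hx : x ≠ 0) : ∃ m : ℤ, ‖algebraMap F L x‖ = ‖π‖ ^ ((p : ℤ) * m) := by
  have hx' : algebraMap F L x ≠ 0 := by simpa using hx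
  obtain ⟨m, hm⟩ := exists_norm_eq_zpow (φ := RingHom.id L) (K := K) hπ0 hπ1 (pow_pos hp 2)
    (by simpa using hK) rfl hrank hx'
  have hm : ‖algebraMap F L x‖ = ‖π‖ ^ m := hm
  obtain ⟨m', hm'⟩ := hK (Algebra.norm K x) (by simpa using hx)
  have h1 : ‖algebraMap K L (Algebra.norm K x)‖ = ‖π‖ ^ (m * p) := by
    rw [IsScalarTower.algebraMap_apply K F L, Algebra.norm_eq_prod_automorphisms, map_prod,
      norm_prod, Finset.prod_congr rfl fun τ _ => (hτ τ x).trans hm, Finset.prod_const,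
      Finset.card_univ, ← Nat.card_eq_fintype_card, IsGalois.card_aut_eq_finrank, hF, zpow_mul,
      zpow_natCast]
  rw [h1] at hm'
  have h2 := (zpow_right_strictAnti₀ hπ0 hπ1).injective hm'
  refine ⟨m', hm.trans (congrArg _ ?_)⟩
  push_cast at h2
  have : (p : ℤ) ≠ 0 := by exact_mod_cast hp.ne'
  exact mul_right_cancel₀ this (by linear_combination h2)

omit [IsUltrametricDist L] in
theorem minpoly_natDegree_of_adjoin_eq_top [FiniteDimensional F L] (hgenF : adjoin F {π} = ⊤) :
    (minpoly F π).natDegree = Module.finrank F L := by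
  rw [← adjoin.finrank (IsIntegral.of_finite F π), hgenF, finrank_top']

omit [IsUltrametricDist L] in
theorem sum_coeff_minpoly [FiniteDimensional F L] (hgenF : adjoin F {π} = ⊤)
    (hFL : Module.finrank F L = p) :
    ∑ j : Fin p, (minpoly F π).coeff j • π ^ (j : ℕ) = -π ^ p := by
  have h := minpoly.aeval F π
  have hdeg := (minpoly_natDegree_of_adjoin_eq_top hgenF).trans hFL
  have hlead : (minpoly F π).coeff p = 1 := by
    rw [← hdeg]; exact minpoly.monic (IsIntegral.of_finite F π)
  rw [aeval_eq_sum_range, hdeg, Finset.sum_range_succ, hlead, one_smul] at h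
  rw [Fin.sum_univ_eq_sum_range (fun j => (minpoly F π).coeff j • π ^ j)]
  exact eq_neg_of_add_eq_zero_left h

theorem norm_coeff_minpoly_le (hp : 0 < p) (hπ0 : 0 < ‖π‖) (hπ1 : ‖π‖ < 1)
    (hF : ∀ x : F, x ≠ 0 → ∃ m : ℤ, ‖algebraMap F L x‖ = ‖π‖ ^ ((p : ℤ) * m))
    [FiniteDimensional F L] (hgenF : adjoin F {π} = ⊤) (hFL : Module.finrank F L = p)
    {j : ℕ} (hj : j < p) : ‖algebraMap F L ((minpoly F π).coeff j)‖ ≤ 1 := by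
  have h := norm_coeff_le_one (φ := RingHom.id L) hπ0 hπ1 hp (by simpa using hF) rfl
    (fun j : Fin p => (minpoly F π).coeff j) (by
      rw [sum_coeff_minpoly hgenF hFL, map_neg, norm_neg, RingHom.id_apply, norm_pow]
      exact pow_le_one₀ hπ0.le hπ1.le) ⟨j, hj⟩
  exact h

theorem norm_coeff_zero_minpoly (hp : 0 < p) (hπ0 : 0 < ‖π‖) (hπ1 : ‖π‖ < 1)
    (hF : ∀ x : F, x ≠ 0 → ∃ m : ℤ, ‖algebraMap F L x‖ = ‖π‖ ^ ((p : ℤ) * m))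
    [FiniteDimensional F L] (hgenF : adjoin F {π} = ⊤) (hFL : Module.finrank F L = p) :
    ‖algebraMap F L ((minpoly F π).coeff 0)‖ = ‖π‖ ^ p := by
  obtain ⟨i, hi⟩ := (exists_norm_sum_eq (φ := RingHom.id L) hπ0 hπ1 hp (by simpa using hF) rfl
    (fun j : Fin p => (minpoly F π).coeff j)).1
  rw [sum_coeff_minpoly hgenF hFL, map_neg, norm_neg, RingHom.id_apply, norm_pow,
    RingHom.id_apply, Algebra.smul_def, norm_mul, norm_pow] at hi
  have h0 : (minpoly F π).coeff i ≠ 0 := by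
    intro h
    rw [h, map_zero, norm_zero, zero_mul] at hi
    exact (pow_pos hπ0 p).ne' hi
  obtain ⟨m, hm⟩ := hF _ h0
  have hi' := hi
  rw [hm, ← zpow_natCast, ← zpow_natCast, ← zpow_add₀ hπ0.ne'] at hi'
  have h1 := (zpow_right_strictAnti₀ hπ0 hπ1).injective hi'
  have h2 : (i : ℕ) = 0 := by
    have h3 : ((i : ℕ) : ℤ) < p := by exact_mod_cast i.2
    have h4 : (p : ℤ) ∣ ((i : ℕ) : ℤ) := ⟨1 - m, by linear_combination -h1⟩
    have := Int.eq_zero_of_dvd_of_nonneg_of_lt (by positivity) h3 h4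
    exact_mod_cast this
  rw [h2, pow_zero, mul_one] at hi
  exact hi.symm

theorem norm_pow_sub_pow_le {x y : L} (hx : ‖x‖ ≤ 1) (hy : ‖y‖ ≤ 1) (n : ℕ) :
    ‖x ^ n - y ^ n‖ ≤ ‖x - y‖ := by
  induction n with
  | zero => simp
  | succ n ih =>
    rw [show x ^ (n + 1) - y ^ (n + 1) = x * (x ^ n - y ^ n) + (x - y) * y ^ n by ring]
    refine ultra_norm_add_le ?_ ?_
    · rw [norm_mul]
      exact (mul_le_of_le_one_left (norm_nonneg _) hx).trans ih
    · rw [norm_mul, norm_pow]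
      exact mul_le_of_le_one_right (norm_nonneg _) (pow_le_one₀ (norm_nonneg _) hy)

/-- An automorphism moves integral elements of `F` at most as far as it moves a uniformizer `n`. -/
theorem norm_aut_sub_le (hp : 0 < p) (hπ0 : 0 < ‖π‖) (hπ1 : ‖π‖ < 1)
    (hK : ∀ x : K, x ≠ 0 → ∃ m : ℤ, ‖algebraMap K L x‖ = ‖π‖ ^ (((p ^ 2 : ℕ) : ℤ) * m))
    (hF : Module.finrank K F = p) (τ : F ≃ₐ[K] F)
    (hτ : ∀ x : F, ‖algebraMap F L (τ x)‖ = ‖algebraMap F L x‖)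
    {n : F} (hn : ‖algebraMap F L n‖ = ‖π‖ ^ p) :
    (τ n = n → τ = 1) ∧ ∀ x : F, ‖algebraMap F L x‖ ≤ 1 →
      ‖algebraMap F L (τ x - x)‖ ≤ ‖algebraMap F L (τ n - n)‖ := by
  have hθ0 := pow_pos hπ0 p
  have hθ1 := pow_lt_one₀ hπ0.le hπ1 hp.ne'
  have hK' : ∀ x : K, x ≠ 0 →
      ∃ m : ℤ, ‖algebraMap F L (algebraMap K F x)‖ = (‖π‖ ^ p) ^ ((p : ℤ) * m) := by
    intro x hx
    obtain ⟨m, hm⟩ := hK x hx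
    refine ⟨m, ?_⟩
    rw [← IsScalarTower.algebraMap_apply, hm, ← zpow_natCast, ← zpow_mul]
    congr 1
    push_cast
    ring
  constructor
  · intro h
    ext x
    obtain ⟨c, rfl⟩ := exists_expansion hθ0 hθ1 hp hK' hn hF x
    simp [h]
  · intro x hx
    obtain ⟨c, rfl⟩ := exists_expansion hθ0 hθ1 hp hK' hn hF x
    have hn1 : ‖algebraMap F L n‖ ≤ 1 := hn.trans_le hθ1.le
    rw [map_sum, ← Finset.sum_sub_distrib, map_sum]
    refine ultra_norm_sum_le _ _ (norm_nonneg _) fun i _ => ?_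
    rw [map_smul, map_pow, ← smul_sub, Algebra.smul_def, map_mul, norm_mul, map_sub, map_sub,
      map_pow, map_pow]
    refine (mul_le_of_le_one_left (norm_nonneg _)
      (norm_coeff_le_one hθ0 hθ1 hp hK' hn c hx i)).trans ?_
    exact norm_pow_sub_pow_le ((hτ n).trans_le hn1) hn1 _

/-- The value at `π` of a nontrivial conjugate of the minimal polynomial of `π` over `F` has norm in
`‖π‖ ^ (p ℤ)`. -/
theorem exists_norm_aeval_conj_eq_zpow (hp : 0 < p) (hπ0 : 0 < ‖π‖) (hπ1 : ‖π‖ < 1)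
    (hK : ∀ x : K, x ≠ 0 → ∃ m : ℤ, ‖algebraMap K L x‖ = ‖π‖ ^ (((p ^ 2 : ℕ) : ℤ) * m))
    (hKF : Module.finrank K F = p)
    (hF : ∀ x : F, x ≠ 0 → ∃ m : ℤ, ‖algebraMap F L x‖ = ‖π‖ ^ ((p : ℤ) * m))
    [FiniteDimensional F L] (hgenF : adjoin F {π} = ⊤) (hFL : Module.finrank F L = p)
    {τ : F ≃ₐ[K] F} (hτ1 : τ ≠ 1)
    (hτ : ∀ x : F, ‖algebraMap F L (τ x)‖ = ‖algebraMap F L x‖) :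
    ∃ m : ℤ, ‖aeval π ((minpoly F π).map (τ : F →+* F))‖ = ‖π‖ ^ ((p : ℤ) * m) := by
  set h := minpoly F π with hh
  set n := h.coeff 0 with hndef
  have hn := norm_coeff_zero_minpoly hp hπ0 hπ1 hF hgenF hFL
  obtain ⟨hfix, hle⟩ := norm_aut_sub_le hp hπ0 hπ1 hK hKF τ hτ hn
  have hne : τ n - n ≠ 0 := fun h => hτ1 (hfix (sub_eq_zero.1 h))
  obtain ⟨m, hm⟩ := hF _ hne
  refine ⟨m, hm ▸ norm_eq_of_norm_sub_lt ?_⟩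
  have hdeg : h.natDegree = p := (minpoly_natDegree_of_adjoin_eq_top hgenF).trans hFL
  have hlead : h.coeff p = 1 := by
    rw [← hdeg]; exact minpoly.monic (IsIntegral.of_finite F π)
  have key : aeval π (h.map (τ : F →+* F)) =
      ∑ j ∈ Finset.range p, algebraMap F L (τ (h.coeff j) - h.coeff j) * π ^ j := by
    have h0 : aeval π h = 0 := minpoly.aeval F π
    rw [← sub_zero (aeval π (h.map (τ : F →+* F))), ← h0, aeval_eq_sum_range, aeval_eq_sum_range,
      natDegree_map, hdeg, ← Finset.sum_sub_distrib, Finset.sum_range_succ, coeff_map, hlead,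
      map_one, sub_self, add_zero]
    refine Finset.sum_congr rfl fun j _ => ?_
    rw [coeff_map, Algebra.smul_def, Algebra.smul_def, map_sub, sub_mul]
    rfl
  have hpos : 0 < ‖algebraMap F L (τ n - n)‖ := norm_pos_iff.2 ((_root_.map_ne_zero _).2 hne)
  rw [key, ← Finset.add_sum_erase _ _ (Finset.mem_range.2 hp), pow_zero, mul_one,
    add_sub_cancel_left]
  refine (ultra_norm_sum_le _ _ (c := ‖algebraMap F L (τ n - n)‖ * ‖π‖) (by positivity)
    fun j hj => ?_).trans_lt (mul_lt_of_lt_one_right hpos hπ1)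
  rw [Finset.mem_erase, Finset.mem_range] at hj
  rw [norm_mul, norm_pow]
  refine mul_le_mul (hle _ (norm_coeff_minpoly_le hp hπ0 hπ1 hF hgenF hFL hj.2)) ?_
    (by positivity) hpos.le
  exact pow_le_of_le_one hπ0.le hπ1.le hj.1

/-- Transitivity of the different, up to norms in `‖π‖ ^ (p ℤ)`. -/
theorem exists_norm_aeval_derivative_eq [FiniteDimensional K L] [DecidableEq (L ≃ₐ[F] L)]
    (hp : 0 < p) (hπ0 : 0 < ‖π‖)
    (hπ1 : ‖π‖ < 1)
    (hK : ∀ x : K, x ≠ 0 → ∃ m : ℤ, ‖algebraMap K L x‖ = ‖π‖ ^ (((p ^ 2 : ℕ) : ℤ) * m))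
    (hrank : Module.finrank K L = p ^ 2) [IsGalois K F] [IsGalois F L]
    (hKF : Module.finrank K F = p)
    (hτ : ∀ (τ : F ≃ₐ[K] F) (x : F), ‖algebraMap F L (τ x)‖ = ‖algebraMap F L x‖)
    (hgen : adjoin K {π} = ⊤) :
    ∃ m : ℤ, ‖aeval π (minpoly K π).derivative‖ =
      ‖π‖ ^ ((p : ℤ) * m) * ∏ σ ∈ (Finset.univ : Finset (L ≃ₐ[F] L)).erase 1, ‖π - σ π‖ := by
  classical
  have hF : ∀ x : F, x ≠ 0 → ∃ m : ℤ, ‖algebraMap F L x‖ = ‖π‖ ^ ((p : ℤ) * m) := fun x hx =>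
    exists_norm_intermediate_eq_zpow hp hπ0 hπ1 hK hrank hKF hτ hx
  have hFL : Module.finrank F L = p := by
    have := Module.finrank_mul_finrank K F L
    rw [hKF, hrank, pow_two] at this
    exact Nat.eq_of_mul_eq_mul_left hp this
  have hgenF : adjoin F {π} = ⊤ := by
    rw [← restrictScalars_eq_top_iff (K := K), eq_top_iff, ← hgen, adjoin_le_iff]
    exact subset_adjoin F {π}
  have hm : ∀ τ : F ≃ₐ[K] F, τ ≠ 1 → ∃ m : ℤ,
      ‖aeval π ((minpoly F π).map (τ : F →+* F))‖ = ‖π‖ ^ ((p : ℤ) * m) := fun τ h =>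
    exists_norm_aeval_conj_eq_zpow hp hπ0 hπ1 hK hKF hF hgenF hFL h (hτ τ)
  choose! M hM using hm
  refine ⟨∑ τ ∈ (Finset.univ : Finset (F ≃ₐ[K] F)).erase 1, M τ, ?_⟩
  have hL : aeval π (minpoly F π).derivative =
      ∏ σ ∈ (Finset.univ : Finset (L ≃ₐ[F] L)).erase 1, (π - σ π) := by
    rw [← eval_map_algebraMap, ← derivative_map, minpoly_map_eq_prod_aut hgenF,
      eval_derivative_prod_of_eval_eq_zero _ _ (Finset.mem_univ (1 : L ≃ₐ[F] L)) (by simp)]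
    simp
  have hid : (minpoly F π).map ((1 : F ≃ₐ[K] F) : F →+* F) = minpoly F π := Polynomial.map_id
  have hK' : aeval π (minpoly K π).derivative = aeval π (minpoly F π).derivative *
      ∏ τ ∈ (Finset.univ : Finset (F ≃ₐ[K] F)).erase 1,
        aeval π ((minpoly F π).map (τ : F →+* F)) := by
    rw [← aeval_map_algebraMap F, ← derivative_map, minpoly_map_eq_prod_conj hgen hgenF,
      ← eval_map_algebraMap, ← derivative_map, Polynomial.map_prod,
      eval_derivative_prod_of_eval_eq_zero _ _ (Finset.mem_univ (1 : F ≃ₐ[K] F))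
        (by rw [hid, eval_map_algebraMap, minpoly.aeval]), hid, derivative_map,
      eval_map_algebraMap]
    simp only [eval_map_algebraMap]
  rw [hK', hL, norm_mul, norm_prod, norm_prod, mul_comm]
  congr 1
  rw [Finset.prod_congr rfl fun τ hτ' => hM τ (Finset.ne_of_mem_erase hτ'), Finset.mul_sum]
  induction ((Finset.univ : Finset (F ≃ₐ[K] F)).erase 1) using Finset.induction_on with
  | empty => simp
  | insert τ S hS ih => rw [Finset.prod_insert hS, Finset.sum_insert hS, zpow_add₀ hπ0.ne', ih]

/-- If `L/F` is Galois and the different exponent of `L/K` is `d` with `p ∤ d + 2`, then some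
automorphism of `L/F` has ramification number different from `1`. -/
theorem exists_aut_norm_ne [FiniteDimensional K L] (hp : 0 < p) (hπ0 : 0 < ‖π‖) (hπ1 : ‖π‖ < 1)
    (hK : ∀ x : K, x ≠ 0 → ∃ m : ℤ, ‖algebraMap K L x‖ = ‖π‖ ^ (((p ^ 2 : ℕ) : ℤ) * m))
    (hrank : Module.finrank K L = p ^ 2) [IsGalois K F] [IsGalois F L]
    (hKF : Module.finrank K F = p)
    (hτ : ∀ (τ : F ≃ₐ[K] F) (x : F), ‖algebraMap F L (τ x)‖ = ‖algebraMap F L x‖)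
    (hgen : adjoin K {π} = ⊤) {d : ℕ} (hd : ‖aeval π (minpoly K π).derivative‖ = ‖π‖ ^ d)
    (hpd : ¬ p ∣ d + 2) : ∃ σ : L ≃ₐ[F] L, σ ≠ 1 ∧ ‖π - σ π‖ ≠ ‖π‖ ^ 2 := by
  classical
  by_contra! hcon
  obtain ⟨m, hm⟩ := exists_norm_aeval_derivative_eq hp hπ0 hπ1 hK hrank hKF hτ hgen
  have hFL : Module.finrank F L = p := by
    have := Module.finrank_mul_finrank K F L
    rw [hKF, hrank, pow_two] at this
    exact Nat.eq_of_mul_eq_mul_left hp this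
  rw [Finset.prod_congr rfl fun σ hσ => hcon σ (Finset.ne_of_mem_erase hσ), Finset.prod_const,
    Finset.card_erase_of_mem (Finset.mem_univ _), Finset.card_univ, ← Nat.card_eq_fintype_card,
    IsGalois.card_aut_eq_finrank, hFL, hd, ← pow_mul, ← zpow_natCast, ← zpow_natCast,
    ← zpow_add₀ hπ0.ne'] at hm
  have h1 := (zpow_right_strictAnti₀ hπ0 hπ1).injective hm
  apply hpd
  have : ((p : ℕ) : ℤ) ∣ ((d + 2 : ℕ) : ℤ) := by
    refine ⟨m + 2, ?_⟩
    push_cast [Nat.cast_sub (show 1 ≤ p from hp)] at h1 ⊢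
    linear_combination h1
  exact_mod_cast this

end Different

section Criterion

variable {K L : Type*} [Field K] [NormedField L] [IsUltrametricDist L] [Algebra K L]
  {p q s ℓ : ℕ} {π : L} {e : ℕ → L}
  {O : Type*} [CommRing O] {κ : Type*} [Field κ] {ι : O →+* L} {ρ : O →+* κ}

/-- In a totally ramified extension every residue comes from the base field. -/
theorem exists_hasResidue_of_finrank (hq : 0 < q) (hπ0 : 0 < ‖π‖) (hπ1 : ‖π‖ < 1)
    (hK : ∀ x : K, x ≠ 0 → ∃ m : ℤ, ‖algebraMap K L x‖ = ‖π‖ ^ ((q : ℤ) * m))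
    (hrank : Module.finrank K L = q)
    (hO : ∀ x : K, ‖algebraMap K L x‖ ≤ 1 → ∃ o, ι o = algebraMap K L x)
    {y : L} (hy : ‖y‖ ≤ 1) : ∃ t, HasResidue ι ρ y t := by
  obtain ⟨c, rfl⟩ := exists_expansion (φ := RingHom.id L) hπ0 hπ1 hq (by simpa using hK) rfl hrank y
  have hc := norm_coeff_le_one (φ := RingHom.id L) hπ0 hπ1 hq (by simpa using hK) rfl c hy
  obtain ⟨o, ho⟩ := hO _ (hc ⟨0, hq⟩)
  refine ⟨ρ o, o, ?_, rfl⟩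
  rw [ho, ← Finset.add_sum_erase _ _ (Finset.mem_univ (⟨0, hq⟩ : Fin q)), pow_zero,
    ← Algebra.algebraMap_eq_smul_one, add_sub_cancel_left]
  refine (ultra_norm_sum_le _ _ hπ0.le fun j hj => ?_).trans_lt hπ1
  have hj0 : (j : ℕ) ≠ 0 := fun h => Finset.ne_of_mem_erase hj (Fin.ext h)
  rw [Algebra.smul_def, norm_mul, norm_pow]
  exact (mul_le_of_le_one_left (by positivity) (hc j)).trans
    (pow_le_of_le_one hπ0.le hπ1.le hj0)

omit [IsUltrametricDist L] in
theorem aeval_minpoly_of_map_eq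
    (hP : (minpoly K π).map (algebraMap K L) = ∑ k ∈ Finset.range (q + 1), C (e k) * X ^ k)
    (y : L) : aeval y (minpoly K π) = ∑ k ∈ Finset.range (q + 1), e k * y ^ k := by
  rw [← eval_map_algebraMap, hP, eval_finsetSum]
  simp

omit [IsUltrametricDist L] in
theorem mul_aeval_derivative_minpoly_of_map_eq
    (hP : (minpoly K π).map (algebraMap K L) = ∑ k ∈ Finset.range (q + 1), C (e k) * X ^ k) :
    π * aeval π (minpoly K π).derivative = ramCoeff e π q 1 := by
  rw [← eval_map_algebraMap, ← derivative_map, hP, derivative_sum, eval_finsetSum,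
    Finset.mul_sum, ramCoeff]
  refine Finset.sum_congr rfl fun k _ => ?_
  rcases k with _ | k
  · simp
  · simp
    ring

theorem RamBounds.isGalois_iff [CharP κ p] [CompleteSpace L] [FiniteDimensional K L]
    (H : RamBounds p q s π e)
    (hℓ : s + p = (p - 1) * ℓ) (hℓ2 : 2 ≤ ℓ) (hℓp : ℓ ≤ p - 1)
    (hP : (minpoly K π).map (algebraMap K L) = ∑ k ∈ Finset.range (q + 1), C (e k) * X ^ k)
    (hι : IsReduction ι ρ) (hρ : Function.Surjective ρ)
    {g a b : O} (hes : e s = p ^ 2 * ι g) (hg : ‖ι g‖ = 1)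
    (het : e (q - p) = p * ι a) (ha : ρ a ≠ 0) {υ : κ} (hυ : HasResidue ι ρ ((p : L) / π ^ q) υ)
    (hυb : υ * ρ b = -1)
    (hK : ∀ x : K, x ≠ 0 → ∃ m : ℤ, ‖algebraMap K L x‖ = ‖π‖ ^ ((q : ℤ) * m))
    (hO : ∀ x : K, ‖algebraMap K L x‖ ≤ 1 → ∃ o, ι o = algebraMap K L x)
    (hrank : Module.finrank K L = q) (hgen : adjoin K {π} = ⊤)
    (hσ : ∀ (σ : L ≃ₐ[K] L) (x : L), ‖σ x‖ = ‖x‖)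
    (F : IntermediateField K L) (hFdeg : Module.finrank K F = p)
    (hFuniq : ∀ F' : IntermediateField K L, Module.finrank K F' = p → F' = F) [IsGalois K F]
    (hτ : ∀ (τ : F ≃ₐ[K] F) (x : F), ‖algebraMap F L (τ x)‖ = ‖algebraMap F L x‖) :
    IsGalois F L ↔ ∃ c : κ, c ≠ 0 ∧ c ^ (p - 1) = (ℓ : κ) * ρ g / (ρ a * ρ b) := by
  have hsq := H.sq
  have hp := H.prime
  have hq : 0 < q := hsq ▸ pow_pos hp.pos 2
  have hπ0 := H.pos
  have hπ1 := H.lt_one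
  have hπ : π ≠ 0 := norm_pos_iff.1 hπ0
  have hroot := aeval_minpoly_of_map_eq hP
  have h0 : ramCoeff e π q 0 = 0 := by rw [ramCoeff_zero, ← hroot, minpoly.aeval]
  have hes1 : ‖e s‖ = ‖π‖ ^ (2 * q) := by
    rw [hes, norm_mul, hg, norm_pow, H.norm_p, mul_one, ← pow_mul, mul_comm]
  have ha1 : ‖ι a‖ = 1 := (HasResidue.coe ι ρ a).norm_eq_one hι ha
  have het1 : ‖e (q - p)‖ = ‖π‖ ^ q := by rw [het, norm_mul, ha1, H.norm_p, mul_one]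
  constructor
  · intro _
    have hd : ‖aeval π (minpoly K π).derivative‖ = ‖π‖ ^ (2 * q + s - 1) := by
      have h1 := H.norm_ramCoeff_one hes1
      rw [← mul_aeval_derivative_minpoly_of_map_eq hP, norm_mul,
        show 2 * q + s = (2 * q + s - 1) + 1 by omega, pow_succ, mul_comm] at h1
      exact mul_right_cancel₀ hπ0.ne' h1
    have hpd : ¬ p ∣ 2 * q + s - 1 + 2 := by
      rintro ⟨k, hk⟩
      have h1 : (p : ℤ) ∣ ((ℓ - 1 : ℕ) : ℤ) := by
        refine ⟨2 * p + ℓ - 1 - k, ?_⟩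
        have h2 : (2 * q + s + 1 : ℤ) = p * k := by
          have : 2 * q + s + 1 = p * k := by omega
          exact_mod_cast this
        have h3 : (s + p : ℤ) = (p - 1) * ℓ := by
          have := congrArg (Nat.cast (R := ℤ)) hℓ
          push_cast [Nat.cast_sub hp.one_le] at this
          exact this
        have h4 : (q : ℤ) = p ^ 2 := by exact_mod_cast hsq
        push_cast [Nat.cast_sub (show 1 ≤ ℓ by omega)]
        linear_combination h3 - h2 + 2 * h4
      have := Nat.le_of_dvd (by omega) (Int.natCast_dvd_natCast.1 h1)
      have := hp.pos
      omega
    obtain ⟨σ, hσ1, hσn⟩ := exists_aut_norm_ne hp.pos hπ0 hπ1 (by simpa [hsq] using hK)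
      (hsq ▸ hrank) hFdeg hτ hgen hd hpd
    set z := σ π / π - 1 with hz
    have hσz : π * (1 + z) = σ π := by rw [hz]; field_simp; ring
    have hgenF : adjoin F {π} = ⊤ := by
      rw [← restrictScalars_eq_top_iff (K := K), eq_top_iff, ← hgen, adjoin_le_iff]
      exact subset_adjoin F {π}
    have hσπ : σ π ≠ π := fun h => hσ1 (injective_aut_apply_of_adjoin_eq_top hgenF h)
    have hzsub : σ π - π = π * z := by rw [← hσz]; ring
    have hz0 : z ≠ 0 := by
      intro h
      rw [h, mul_zero] at hzsub
      exact hσπ (sub_eq_zero.1 hzsub)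
    have hz1 : ‖z‖ ≤ 1 := by
      refine ultra_norm_sub_le ?_ norm_one.le
      rw [norm_div, show ‖σ π‖ = ‖π‖ from hσ (σ.restrictScalars K) π, div_self hπ0.ne']
    have hz2 : ‖z‖ ≠ ‖π‖ ^ 1 := by
      intro h
      apply hσn
      rw [norm_sub_rev, hzsub, norm_mul, h]
      ring
    have hsum : ∑ j ∈ Finset.range (q + 1), ramCoeff e π q j * z ^ j = 0 := by
      rw [sum_ramCoeff_mul_pow, hσz, ← hroot,
        show σ π = (σ.restrictScalars K) π from rfl, aeval_algHom_apply, minpoly.aeval, map_zero]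
    obtain ⟨m, hm⟩ := exists_norm_eq_zpow (φ := RingHom.id L) (K := K) hπ0 hπ1 hq
      (by simpa using hK) rfl hrank hz0
    have hm : ‖z‖ = ‖π‖ ^ m := hm
    have hm0 : 0 ≤ m := by
      rwa [hm, ← zpow_zero ‖π‖, (zpow_right_strictAnti₀ hπ0 hπ1).le_iff_ge] at hz1
    lift m to ℕ using hm0
    rw [zpow_natCast] at hm
    have hmℓ := (H.eq_one_or_eq hℓ hes1 het1 h0 hm hsum).resolve_left fun h => hz2 (h ▸ hm)
    exact H.exists_residual_root hℓ hℓ2 h0 hι hes het hυ hυb ha (fun y hy =>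
      exists_hasResidue_of_finrank hq hπ0 hπ1 hK hrank hO hy.le) (hmℓ ▸ hm) hsum
  · rintro ⟨c, hc0, hc⟩
    obtain ⟨z, hz0, hz⟩ := H.exists_root_of_residual_root hℓ hℓ2 h0 hι hρ hes hg het hυ hυb ha
      hc0 hc
    rw [sum_ramCoeff_mul_pow, ← hroot] at hz
    obtain ⟨σ, hσz⟩ := exists_aut_apply_eq hgen hz
    refine isGalois_of_unique_of_aut_ne_one hp (hsq ▸ hrank) hFuniq (σ := σ) ?_
    rintro rfl
    have : π * z = 0 := by
      have h : π = π * (1 + z) := hσz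
      linear_combination -h
    exact (mul_ne_zero hπ hz0) this

end Criterion

section Eisenstein

variable {L : Type*} [NormedField L] [IsUltrametricDist L] {q : ℕ} {π c : L} {e : ℕ → L}

/-- The norm of a root of an Eisenstein polynomial. -/
theorem norm_lt_one_of_eisenstein (hc : ‖c‖ < 1) (hmonic : e q = 1)
    (he : ∀ k < q, ‖e k‖ ≤ ‖c‖) (h : ∑ k ∈ Finset.range (q + 1), e k * π ^ k = 0) : ‖π‖ < 1 := by
  by_contra! hcon
  rw [Finset.sum_range_succ, hmonic, one_mul] at h
  have h1 : ‖π ^ q‖ ≤ ‖c‖ * ‖π‖ ^ q := by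
    rw [eq_neg_of_add_eq_zero_right h, norm_neg]
    refine ultra_norm_sum_le _ _ (by positivity) fun k hk => ?_
    rw [Finset.mem_range] at hk
    rw [norm_mul, norm_pow]
    exact mul_le_mul (he k hk) (pow_le_pow_right₀ hcon hk.le) (by positivity) (norm_nonneg _)
  rw [norm_pow] at h1
  have h2 : 0 < ‖π‖ ^ q := pow_pos (by linarith) q
  nlinarith

theorem norm_pow_add_lt_of_eisenstein (hq : 0 < q) (hc0 : c ≠ 0) (hπ : ‖π‖ < 1)
    (hmonic : e q = 1) (he : ∀ k < q, ‖e k‖ ≤ ‖c‖)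
    (h : ∑ k ∈ Finset.range (q + 1), e k * π ^ k = 0) : ‖π ^ q + e 0‖ < ‖c‖ := by
  rw [Finset.sum_range_succ, hmonic, one_mul,
    ← Finset.add_sum_erase _ _ (Finset.mem_range.2 hq), pow_zero, mul_one] at h
  have h1 : π ^ q + e 0 = -∑ k ∈ (Finset.range q).erase 0, e k * π ^ k := by
    linear_combination h
  have hc : 0 < ‖c‖ := norm_pos_iff.2 hc0
  rw [h1, norm_neg]
  refine (ultra_norm_sum_le _ _ (c := ‖c‖ * ‖π‖) (by positivity) fun k hk => ?_).trans_lt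
    (mul_lt_of_lt_one_right hc hπ)
  rw [Finset.mem_erase, Finset.mem_range] at hk
  rw [norm_mul, norm_pow]
  exact mul_le_mul (he k hk.2) (pow_le_of_le_one (norm_nonneg _) hπ.le hk.1) (by positivity)
    hc.le

end Eisenstein

section Reduction

variable {L : Type*} [NormedField L] [IsUltrametricDist L] {O : Type*} [CommRing O]
  {κ : Type*} [Field κ] {ι : O →+* L} {ρ : O →+* κ}

theorem exists_hasResidue_of_norm_add_one_lt (hι : IsReduction ι ρ) (hρ : Function.Surjective ρ)
    {x : L} {b : O} (hb : ρ b ≠ 0) (h : ‖x * ι b + 1‖ < 1) :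
    ∃ υ, HasResidue ι ρ x υ ∧ υ * ρ b = -1 := by
  obtain ⟨o, ho⟩ := hρ (-1 / ρ b)
  have hob : ρ o * ρ b = -1 := by rw [ho]; field_simp
  refine ⟨ρ o, ⟨o, ?_, rfl⟩, hob⟩
  have hb1 : ‖ι b‖ = 1 := (HasResidue.coe ι ρ b).norm_eq_one hι hb
  have h1 : ‖ι (o * b + 1)‖ < 1 := by rw [hι.norm_lt_iff, map_add, map_mul, hob, map_one]; ring
  have h2 : (x - ι o) * ι b = (x * ι b + 1) - ι (o * b + 1) := by
    rw [map_add, map_mul, map_one]; ring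
  rw [← mul_one ‖x - ι o‖, ← hb1, ← norm_mul, h2, hb1]
  exact ultra_norm_sub_lt h h1

end Reduction

section Field

variable {K : Type*} [Field K]

/-- The monic polynomial `X ^ n + f 1 * X ^ (n - 1) + ⋯ + f n`, in increasing powers of `X`. -/
theorem X_pow_add_sum_eq (n : ℕ) (f : ℕ → K) :
    (X ^ n + ∑ i ∈ Finset.range n, C (f (i + 1)) * X ^ (n - (i + 1)) : K[X]) =
      ∑ k ∈ Finset.range (n + 1), C (if k = n then 1 else f (n - k)) * X ^ k := by
  rw [Finset.sum_range_succ, if_pos rfl, C_1, one_mul, add_comm]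
  congr 1
  rw [← Finset.sum_range_reflect]
  refine Finset.sum_congr rfl fun k hk => ?_
  rw [Finset.mem_range] at hk
  rw [if_neg hk.ne, show n - 1 - k + 1 = n - k by omega, show n - (n - k) = k by omega]

theorem monic_X_pow_add_sum (n : ℕ) (f : ℕ → K) :
    (X ^ n + ∑ i ∈ Finset.range n, C (f (i + 1)) * X ^ (n - (i + 1)) : K[X]).Monic ∧
    (X ^ n + ∑ i ∈ Finset.range n, C (f (i + 1)) * X ^ (n - (i + 1)) : K[X]).natDegree = n := by
  have h : (∑ i ∈ Finset.range n, C (f (i + 1)) * X ^ (n - (i + 1)) : K[X]).degree < n := by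
    refine (degree_sum_le _ _).trans_lt ((Finset.sup_lt_iff (WithBot.bot_lt_coe n)).2 fun i hi => ?_)
    rw [Finset.mem_range] at hi
    refine (degree_C_mul_X_pow_le _ _).trans_lt ?_
    exact Nat.cast_lt.2 (by omega)
  exact ⟨monic_X_pow_add h, by
    rw [natDegree_add_eq_left_of_degree_lt (by rwa [degree_X_pow]), natDegree_X_pow]⟩

theorem minpoly_eq_of_norm {L : Type*} [NormedField L] [IsUltrametricDist L] [Algebra K L]
    [FiniteDimensional K L] {n : ℕ} (hn : 0 < n) {π : L} (hπ0 : 0 < ‖π‖) (hπ1 : ‖π‖ < 1)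
    (hK : ∀ x : K, x ≠ 0 → ∃ m : ℤ, ‖algebraMap K L x‖ = ‖π‖ ^ ((n : ℤ) * m))
    (hgen : adjoin K {π} = ⊤) {P : K[X]} (hP : P.Monic) (hdeg : P.natDegree = n)
    (hroot : aeval π P = 0) : Module.finrank K L = n ∧ minpoly K π = P := by
  have hint := IsIntegral.of_finite K π
  have h1 : n ≤ Module.finrank K L := by
    have := (linearIndependent_pow_of_norm (φ := RingHom.id L) hπ0 hπ1 hn (by simpa using hK)
      rfl).fintype_card_le_finrank
    rwa [Fintype.card_fin] at this
  have h2 : (minpoly K π).natDegree = Module.finrank K L := by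
    rw [← adjoin.finrank hint, hgen, finrank_top']
  have h3 : (minpoly K π).natDegree ≤ P.natDegree :=
    natDegree_le_of_dvd (minpoly.dvd K π hroot) hP.ne_zero
  refine ⟨by omega, (eq_of_monic_of_dvd_of_natDegree_le (minpoly.monic hint) hP
    (minpoly.dvd K π hroot) (by omega)).symm⟩

end Field

/-- The criterion over a base field whose norm is governed by a ring `O` with uniformizer `p`. -/
theorem isGalois_iff_of_norm {p q : ℕ} (hp : p.Prime) (hodd : Odd p) (hq : q = p ^ 2)
    {K L : Type*} [Field K] [NormedField L] [IsUltrametricDist L] [CompleteSpace L] [Algebra K L]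
    {O : Type*} [CommRing O] [IsDomain O] {κ : Type*} [Field κ] [CharP κ p] (j : O →+* K)
    (ρ : O →+* κ)
    (hρ : Function.Surjective ρ) (hker : RingHom.ker ρ = Ideal.span {(p : O)})
    (hp0 : (p : L) ≠ 0) (hp1 : ‖(p : L)‖ < 1)
    (hj : ∀ o, ‖algebraMap K L (j o)‖ ≤ 1)
    (hunit : ∀ o, ¬ (p : O) ∣ o → ‖algebraMap K L (j o)‖ = 1)
    (hK : ∀ x : K, x ≠ 0 → ∃ m : ℤ, ‖algebraMap K L x‖ = ‖(p : L)‖ ^ m)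
    (hO : ∀ x : K, ‖algebraMap K L x‖ ≤ 1 → ∃ o, j o = x)
    {ℓ r : ℕ} (hℓ2 : 2 ≤ ℓ) (hℓp : ℓ ≤ p - 1) (hr : r = q - (p - 1) * ℓ + p)
    {f : ℕ → O} (hfE : ∀ i, 1 ≤ i → i ≤ q → (p : O) ∣ f i) (hfE' : ¬ (p : O) ^ 2 ∣ f q)
    {a b : O} {g : ℕ → O} (ha : f p = p * a) (hb : f q = p * b)
    (hg : ∀ i, 1 ≤ i → i < q → i ≠ p → f i = p ^ 2 * g i) (hfp : ¬ (p : O) ^ 2 ∣ f p)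
    (hfr : ¬ (p : O) ^ 3 ∣ f r)
    (hf3 : ∀ i, r + 1 ≤ i → i ≤ q - 1 → Nat.Coprime i p → (p : O) ^ 3 ∣ f i) {π : L}
    (hπ : aeval π (X ^ q + ∑ i ∈ Finset.range q,
      C (j (f (i + 1))) * X ^ (q - (i + 1)) : K[X]) = 0)
    (hgen : adjoin K {π} = ⊤) (hσ : ∀ (σ : L ≃ₐ[K] L) (x : L), ‖σ x‖ = ‖x‖)
    (F : IntermediateField K L) (hFdeg : Module.finrank K F = p)
    (hFuniq : ∀ F' : IntermediateField K L, Module.finrank K F' = p → F' = F) [IsGalois K F]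
    (hτ : ∀ (τ : F ≃ₐ[K] F) (x : F), ‖algebraMap F L (τ x)‖ = ‖algebraMap F L x‖) :
    IsGalois F L ↔ ∃ c : κ, c ≠ 0 ∧ c ^ (p - 1) = (ℓ : κ) * ρ (g r) / (ρ a * ρ b) := by
  set ι : O →+* L := (algebraMap K L).comp j with hιdef
  set e : ℕ → L := fun k => if k = q then 1 else ι (f (q - k)) with he
  have hp3 : 3 ≤ p := by
    have h2 := hp.two_le
    rcases hodd with ⟨m, hm⟩
    omega
  have hqp : p * p = q := by rw [hq, pow_two]
  have h3p : 3 * p ≤ q := by rw [← hqp]; exact Nat.mul_le_mul_right p hp3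
  have hq0 : 0 < q := by omega
  have hpO : (p : O) ≠ 0 := by
    intro h
    apply hp0
    rw [← map_natCast ι, h, map_zero]
  have hρ0 : ∀ o, ρ o = 0 ↔ (p : O) ∣ o := by
    intro o
    rw [← RingHom.mem_ker, hker, Ideal.mem_span_singleton]
  have hιp : ι (p : O) = (p : L) := map_natCast ι p
  have hι : IsReduction ι ρ := by
    refine ⟨hj, fun o => ⟨fun h => ?_, fun h => ?_⟩⟩
    · rw [hρ0]
      by_contra hcon
      exact h.ne (hunit o hcon)
    · obtain ⟨d, rfl⟩ := (hρ0 o).1 h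
      rw [map_mul, hιp, norm_mul]
      exact (mul_le_of_le_one_right (norm_nonneg _) (hj d)).trans_lt hp1
  have hdvd : ∀ {n : ℕ} {o : O}, (p : O) ^ n ∣ o → ‖ι o‖ ≤ ‖(p : L)‖ ^ n := by
    rintro n _ ⟨d, rfl⟩
    rw [map_mul, map_pow, hιp, norm_mul, norm_pow]
    exact mul_le_of_le_one_right (by positivity) (hj d)
  have ha0 : ρ a ≠ 0 := by
    rw [Ne, hρ0]
    intro h
    exact hfp (by rw [ha, pow_two]; exact mul_dvd_mul_left _ h)
  have hb0 : ρ b ≠ 0 := by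
    rw [Ne, hρ0]
    intro h
    exact hfE' (by rw [hb, pow_two]; exact mul_dvd_mul_left _ h)
  have hea : e q = 1 := if_pos rfl
  have hek : ∀ k < q, e k = ι (f (q - k)) := fun k hk => if_neg hk.ne
  have hele : ∀ k < q, ‖e k‖ ≤ ‖(p : L)‖ := by
    intro k hk
    rw [hek k hk, ← pow_one ‖(p : L)‖]
    exact hdvd (by rw [pow_one]; exact hfE _ (by omega) (by omega))
  have hPmap : (X ^ q + ∑ i ∈ Finset.range q, C (j (f (i + 1))) * X ^ (q - (i + 1)) : K[X]).map
      (algebraMap K L) = ∑ k ∈ Finset.range (q + 1), C (e k) * X ^ k := by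
    rw [X_pow_add_sum_eq q fun i => j (f i), Polynomial.map_sum]
    refine Finset.sum_congr rfl fun k _ => ?_
    rw [Polynomial.map_mul, Polynomial.map_pow, map_X, map_C, he]
    simp only
    split_ifs
    · rw [map_one]
    · rfl
  have hsum : ∑ k ∈ Finset.range (q + 1), e k * π ^ k = 0 := by
    rw [← eval_map_algebraMap, hPmap, eval_finsetSum] at hπ
    simpa using hπ
  have hπ1 := norm_lt_one_of_eisenstein hp1 hea hele hsum
  have hadd := norm_pow_add_lt_of_eisenstein hq0 hp0 hπ1 hea hele hsum
  have he0 : e 0 = p * ι b := by rw [hek 0 hq0, Nat.sub_zero, hb, map_mul, hιp]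
  have hb1 : ‖ι b‖ = 1 := (HasResidue.coe ι ρ b).norm_eq_one hι hb0
  have hpq : ‖(p : L)‖ = ‖π‖ ^ q := by
    have h1 : ‖-e 0‖ = ‖(p : L)‖ := by rw [norm_neg, he0, norm_mul, hb1, mul_one]
    rw [← norm_pow, ← h1]
    refine (norm_eq_of_norm_sub_lt ?_).symm
    rwa [sub_neg_eq_add, h1]
  have hπ0 : 0 < ‖π‖ := by
    refine (norm_nonneg π).lt_of_ne fun h => hp0 (norm_eq_zero.1 ?_)
    rw [hpq, ← h, zero_pow hq0.ne']
  have hπne : π ≠ 0 := norm_pos_iff.1 hπ0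
  obtain ⟨υ, hυ, hυb⟩ := exists_hasResidue_of_norm_add_one_lt hι hρ (x := (p : L) / π ^ q) hb0 (by
    rw [show (p : L) / π ^ q * ι b + 1 = (π ^ q + e 0) / π ^ q by rw [he0]; field_simp; ring,
      norm_div, norm_pow, ← hpq]
    exact (div_lt_one (norm_pos_iff.2 hp0)).2 hadd)
  have hKq : ∀ x : K, x ≠ 0 → ∃ m : ℤ, ‖algebraMap K L x‖ = ‖π‖ ^ ((q : ℤ) * m) := by
    intro x hx
    obtain ⟨m, hm⟩ := hK x hx
    exact ⟨m, by rw [hm, hpq, zpow_mul, zpow_natCast]⟩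
  obtain ⟨hPmon, hPdeg⟩ := monic_X_pow_add_sum q fun i => j (f i)
  have : FiniteDimensional K L := by
    have hint : IsIntegral K π := ⟨_, hPmon, hπ⟩
    have := adjoin.finiteDimensional hint
    rw [hgen] at this
    exact topEquiv.toLinearEquiv.finiteDimensional
  obtain ⟨hrank, hmin⟩ := minpoly_eq_of_norm hq0 hπ0 hπ1 hKq hgen hPmon hPdeg hπ
  have h1 : (p - 1) * ℓ = p * ℓ - ℓ := by rw [Nat.sub_mul, one_mul]
  have h2 : (p - 1) * ℓ ≤ (p - 1) * (p - 1) := Nat.mul_le_mul_left _ hℓp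
  have h3 : (p - 1) * (p - 1) + 2 * p = q + 1 := by
    obtain ⟨m, rfl⟩ : ∃ m, p = m + 1 := ⟨p - 1, by omega⟩
    rw [← hqp, Nat.add_sub_cancel]
    ring
  have h4 : (p - 1) * 2 ≤ (p - 1) * ℓ := Nat.mul_le_mul_left _ hℓ2
  obtain ⟨s, hs⟩ : ∃ s, s + p = (p - 1) * ℓ := ⟨(p - 1) * ℓ - p, by omega⟩
  have hrs : q - s = r := by omega
  have hps : ¬ p ∣ s := by
    intro h
    have h5 : p ∣ (p - 1) * ℓ + ℓ := by
      rw [h1, Nat.sub_add_cancel (Nat.le_mul_of_pos_left _ (by omega))]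
      exact dvd_mul_right _ _
    rw [Nat.dvd_add_right (hs ▸ dvd_add h dvd_rfl)] at h5
    have := Nat.le_of_dvd (by omega) h5
    omega
  have hcop : ∀ k, ¬ p ∣ k → k < q → Nat.Coprime (q - k) p := by
    intro k hk hkq
    refine Nat.Coprime.symm ((Nat.Prime.coprime_iff_not_dvd hp).2 fun h => hk ?_)
    have h5 : p ∣ q := hqp ▸ dvd_mul_right p p
    rwa [Nat.dvd_sub_iff_right hkq.le h5] at h
  have hgr : f r = p ^ 2 * g r := hg r (by omega) (by omega) (by omega)
  have H : RamBounds p q s π e :=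
    { prime := hp
      sq := hq
      s_pos := by omega
      s_lt := by omega
      not_dvd := hps
      pos := hπ0
      lt_one := hπ1
      norm_p := hpq
      monic := hea
      norm_le := by
        intro k hk hkq hkp
        rw [mul_comm, pow_mul, ← hpq, hek k hkq]
        refine hdvd ?_
        rw [hg (q - k) (by omega) (by omega) (by omega)]
        exact dvd_mul_right _ _
      norm_le_of_lt := by
        intro k hk hks
        have hk0 : k ≠ 0 := by rintro rfl; exact hk (dvd_zero p)
        rw [mul_comm, pow_mul, ← hpq, hek k (by omega)]
        exact hdvd (hf3 _ (by omega) (by omega) (hcop k hk (by omega)))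
      norm_le_tame := by
        rw [← hpq]
        exact hele _ (by omega) }
  refine H.isGalois_iff hs hℓ2 hℓp (hmin ▸ hPmap) hι hρ (g := g r) (a := a) (b := b) ?_ ?_ ?_ ha0
    hυ hυb hKq (fun x hx => ?_) hrank hgen hσ F hFdeg hFuniq hτ
  · rw [hek s (by omega), hrs, hgr, map_mul, map_pow, hιp]
  · refine hunit _ fun h => hfr ?_
    rw [hgr, pow_succ _ 2]
    exact mul_dvd_mul_left _ h
  · rw [hek _ (by omega), show q - (q - p) = p by omega, ha, map_mul, hιp]
  · obtain ⟨o, rfl⟩ := hO x hx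
    exact ⟨o, rfl⟩

section LocalRing

variable {O K L : Type*} [CommRing O] [Field K] [NormedField L] {j : O →+* K} {φ : K →+* L} {p : ℕ}

theorem norm_eq_one_of_isUnit (hj : ∀ o, ‖φ (j o)‖ ≤ 1) {o : O} (ho : IsUnit o) :
    ‖φ (j o)‖ = 1 := by
  obtain ⟨u, rfl⟩ := ho
  refine (hj _).antisymm (not_lt.1 fun h => ?_)
  have h1 : ‖φ (j (u * ↑u⁻¹))‖ = 1 := by simp
  rw [map_mul, map_mul, norm_mul] at h1
  exact (mul_lt_one_of_nonneg_of_lt_one_left (norm_nonneg _) h (hj _)).ne h1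

/-- If `p` divides every nonunit then a nonzero element of `O` is a power of `p` times a unit. -/
theorem exists_eq_pow_mul_isUnit (hloc : ∀ o : O, ¬ IsUnit o → (p : O) ∣ o)
    (hp1 : ‖(p : L)‖ < 1) (hj : ∀ o, ‖φ (j o)‖ ≤ 1) {o : O} (ho : j o ≠ 0) :
    ∃ (m : ℕ) (u : O), IsUnit u ∧ o = p ^ m * u := by
  classical
  have hpos : 0 < ‖φ (j o)‖ := norm_pos_iff.2 ((_root_.map_ne_zero φ).2 ho)
  have hex : ∃ n, ¬ (p : O) ^ n ∣ o := by
    obtain ⟨n, hn⟩ := exists_pow_lt_of_lt_one hpos hp1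
    refine ⟨n, ?_⟩
    rintro ⟨d, rfl⟩
    refine hn.not_ge ?_
    rw [map_mul, map_mul, map_pow, map_pow, map_natCast, map_natCast, norm_mul, norm_pow]
    exact mul_le_of_le_one_right (by positivity) (hj d)
  obtain ⟨m, hm⟩ : ∃ m, Nat.find hex = m + 1 := Nat.exists_eq_succ_of_ne_zero fun h =>
    Nat.find_spec hex (by rw [h, pow_zero]; exact one_dvd o)
  obtain ⟨d, hd⟩ := not_not.1 (Nat.find_min hex (show m < Nat.find hex by omega))
  refine ⟨m, d, ?_, hd⟩
  by_contra hu
  apply Nat.find_spec hex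
  rw [hm, hd, pow_succ]
  exact mul_dvd_mul_left _ (hloc d hu)

theorem exists_eq_zpow_mul_isUnit (hloc : ∀ o : O, ¬ IsUnit o → (p : O) ∣ o) (hp0 : (p : K) ≠ 0)
    (hp1 : ‖(p : L)‖ < 1) (hj : ∀ o, ‖φ (j o)‖ ≤ 1)
    (hfrac : ∀ x : K, ∃ d o, j d ≠ 0 ∧ j d * x = j o) {x : K} (hx : x ≠ 0) :
    ∃ (m : ℤ) (u : O), IsUnit u ∧ x = p ^ m * j u := by
  obtain ⟨d, o, hd, h⟩ := hfrac x
  obtain ⟨m, u, hu, rfl⟩ := exists_eq_pow_mul_isUnit hloc hp1 hj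
    (show j o ≠ 0 from h ▸ mul_ne_zero hd hx)
  obtain ⟨n, v, ⟨v, rfl⟩, rfl⟩ := exists_eq_pow_mul_isUnit hloc hp1 hj hd
  refine ⟨m - n, u * ↑v⁻¹, hu.mul v⁻¹.isUnit, ?_⟩
  have hv : j v * j ↑v⁻¹ = 1 := by rw [← map_mul, Units.mul_inv, map_one]
  simp only [map_mul, map_pow, map_natCast] at h hd ⊢
  rw [zpow_sub₀ hp0, zpow_natCast, zpow_natCast]
  refine mul_left_cancel₀ hd (h.trans ?_)
  field_simp
  linear_combination (-j u) * hv

theorem exists_norm_eq_natCast_zpow (hloc : ∀ o : O, ¬ IsUnit o → (p : O) ∣ o) (hp0 : (p : K) ≠ 0)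
    (hp1 : ‖(p : L)‖ < 1) (hj : ∀ o, ‖φ (j o)‖ ≤ 1)
    (hfrac : ∀ x : K, ∃ d o, j d ≠ 0 ∧ j d * x = j o) {x : K} (hx : x ≠ 0) :
    ∃ m : ℤ, ‖φ x‖ = ‖(p : L)‖ ^ m := by
  obtain ⟨m, u, hu, rfl⟩ := exists_eq_zpow_mul_isUnit hloc hp0 hp1 hj hfrac hx
  exact ⟨m, by rw [map_mul, norm_mul, norm_eq_one_of_isUnit hj hu, mul_one, map_zpow₀, norm_zpow,
    map_natCast]⟩

theorem exists_eq_of_norm_le_one (hloc : ∀ o : O, ¬ IsUnit o → (p : O) ∣ o) (hp0 : (p : K) ≠ 0)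
    (hp1 : ‖(p : L)‖ < 1) (hj : ∀ o, ‖φ (j o)‖ ≤ 1)
    (hfrac : ∀ x : K, ∃ d o, j d ≠ 0 ∧ j d * x = j o) {x : K} (hx : ‖φ x‖ ≤ 1) :
    ∃ o, j o = x := by
  by_cases hx0 : x = 0
  · exact ⟨0, by rw [map_zero, hx0]⟩
  obtain ⟨m, u, hu, rfl⟩ := exists_eq_zpow_mul_isUnit hloc hp0 hp1 hj hfrac hx0
  have hpL : 0 < ‖(p : L)‖ := by
    rw [norm_pos_iff, ← map_natCast φ]
    exact (_root_.map_ne_zero φ).2 hp0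
  rw [map_mul, norm_mul, norm_eq_one_of_isUnit hj hu, mul_one, map_zpow₀, norm_zpow,
    map_natCast, ← zpow_zero ‖(p : L)‖, (zpow_right_strictAnti₀ hpL hp1).le_iff_ge] at hx
  lift m to ℕ using hx
  exact ⟨p ^ m * u, by simp⟩

end LocalRing

section Integral

/-- An element integral over a ring mapping to the unit ball lies in the unit ball. -/
theorem norm_le_one_of_isIntegral {R L : Type*} [CommRing R] [NormedField L] [IsUltrametricDist L]
    {ψ : R →+* L} (hψ : ∀ a, ‖ψ a‖ ≤ 1) {x : L} (hx : ψ.IsIntegralElem x) : ‖x‖ ≤ 1 := by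
  obtain ⟨P, hP, h⟩ := hx
  by_contra! hcon
  rw [eval₂_eq_sum_range, Finset.sum_range_succ, coeff_natDegree, hP.leadingCoeff, map_one,
    one_mul] at h
  set n := P.natDegree with hn
  have h1 : ‖x ^ n‖ ≤ ‖x‖ ^ n / ‖x‖ := by
    rw [eq_neg_of_add_eq_zero_right h, norm_neg]
    refine ultra_norm_sum_le _ _ (by positivity) fun k hk => ?_
    rw [Finset.mem_range] at hk
    rw [norm_mul, norm_pow, le_div_iff₀ (by linarith), mul_assoc, ← pow_succ]
    exact (mul_le_of_le_one_left (by positivity) (hψ _)).trans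
      (pow_le_pow_right₀ hcon.le hk)
  rw [norm_pow] at h1
  exact (div_lt_self (pow_pos (by linarith) n) hcon).not_ge h1

end Integral

section Spectral

variable (k L : Type*) [NontriviallyNormedField k] [CompleteSpace k] [IsUltrametricDist k]

theorem exists_normedField_norm_eq_spectralNorm [I : Field L] [Algebra k L]
    [FiniteDimensional k L] :
    ∃ N : NormedField L, N.toField = I ∧ (∀ x : L, ‖x‖ = spectralNorm k L x) ∧
      IsUltrametricDist L ∧ CompleteSpace L := by
  refine ⟨spectralNorm.normedField k L, rfl, fun _ => rfl, ?_, ?_⟩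
  · let := spectralNorm.normedField k L
    exact IsUltrametricDist.isUltrametricDist_of_isNonarchimedean_norm
      (isNonarchimedean_spectralNorm (K := k) (L := L))
  · exact spectralNorm.completeSpace k L

end Spectral

section Padic

variable {p : ℕ} [Fact p.Prime] {K : Type} [Field K] [Algebra ℚ_[p] K]

instance : IsScalarTower ℤ_[p] ℚ_[p] K := IsScalarTower.of_algebraMap_eq fun _ => rfl

theorem exists_integralClosure_mul_eq [FiniteDimensional ℚ_[p] K] (x : K) :
    ∃ d o : integralClosure ℤ_[p] K, (d : K) ≠ 0 ∧ (d : K) * x = o := by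
  obtain ⟨y, hy, h⟩ := ((IsFractionRing.isAlgebraic_iff ℤ_[p] ℚ_[p] K).2
    (Algebra.IsAlgebraic.isAlgebraic x)).exists_integral_multiple
  refine ⟨algebraMap ℤ_[p] _ y, ⟨y • x, h⟩, ?_, (Algebra.smul_def y x).symm⟩
  change algebraMap ℚ_[p] K (y : ℚ_[p]) ≠ 0
  rw [_root_.map_ne_zero]
  simpa using hy

theorem norm_integralClosure_le_one {L : Type*} [NormedField L] [IsUltrametricDist L] [Algebra K L]
    (hnorm : ∀ x : ℚ_[p], ‖algebraMap K L (algebraMap ℚ_[p] K x)‖ = ‖x‖)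
    (o : integralClosure ℤ_[p] K) : ‖algebraMap K L o‖ ≤ 1 := by
  refine norm_le_one_of_isIntegral (R := ℤ_[p])
    (ψ := (algebraMap K L).comp (algebraMap ℤ_[p] K)) (fun a => ?_) ?_
  · exact (hnorm a).trans_le a.norm_le_one
  · obtain ⟨P, hP, h⟩ := o.2
    refine ⟨P, hP, ?_⟩
    rw [← hom_eval₂, h, map_zero]

end Padic

/-- Let `2 ≤ ℓ ≤ p−1`, `r = p² − (p−1)ℓ + p`, and let `f` be an Eisenstein
polynomial of degree `p²` over a finite unramified `K/ℚ_p` (`p` odd) with `v_p(f_p) = 1`,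
`v_p(f_{pi}) ≥ 2` for `i ∈ 𝕀(2,p−1)`, `v_p(f_i) ≥ 2` for `i ∈ 𝕀(1,r−1)`, `v_p(f_r) = 2`,
`v_p(f_i) ≥ 3` for `i ∈ 𝕀(r+1,p²−1)`, and `−F_p/F_{p²} ∈ (κ^×)^{p−1}`.  Let `L = K(π)` and
`F` the unique degree-`p` subextension of `L/K` (Galois over `K`).  Then `L/F` is Galois if and
only if `ℓ·G_r/(F_p·F_{p²}) ∈ (κ^×)^{p−1}`. -/
theorem stmt16 (p : ℕ) [Fact (Nat.Prime p)] (hodd : Odd p)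
    (K : Type) [Field K] [Algebra ℚ_[p] K] [FiniteDimensional ℚ_[p] K]
    (hKloc : ∀ x : integralClosure ℤ_[p] K, ¬IsUnit x → (p : integralClosure ℤ_[p] K) ∣ x)
    (hKp : ¬IsUnit (p : integralClosure ℤ_[p] K))
    -- the residue field
    (κ : Type) [Field κ] [Finite κ] [CharP κ p]
    (ρ : integralClosure ℤ_[p] K →+* κ) (hρ : Function.Surjective ρ)
    (hker : RingHom.ker ρ = Ideal.span {(p : integralClosure ℤ_[p] K)})
    -- the indices
    (ℓ r : ℕ) (hℓ2 : 2 ≤ ℓ) (hℓp : ℓ ≤ p - 1) (hr : r = p ^ 2 - (p - 1) * ℓ + p)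
    -- an Eisenstein polynomial of degree `p²`
    (f : ℕ → integralClosure ℤ_[p] K)
    (hfE : ∀ i, 1 ≤ i → i ≤ p ^ 2 → (p : integralClosure ℤ_[p] K) ∣ f i)
    (hfE' : ¬(p : integralClosure ℤ_[p] K) ^ 2 ∣ f (p ^ 2))
    -- witnesses for `F_p = ρ a`, `F_{p²} = ρ b`, `G_i = ρ (g i)`
    (a b : integralClosure ℤ_[p] K) (g : ℕ → integralClosure ℤ_[p] K)
    (ha : f p = p * a) (hb : f (p ^ 2) = p * b)
    (hg : ∀ i, 1 ≤ i → i < p ^ 2 → i ≠ p → f i = p ^ 2 * g i)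
    -- `v_p(f_p) = 1` and `v_p(f_{pi}) ≥ 2` for `i ∈ 𝕀(2,p−1)`
    (hR1a : ¬(p : integralClosure ℤ_[p] K) ^ 2 ∣ f p)
    (hR1b : ∀ i, 2 ≤ i → i ≤ p - 1 → Nat.Coprime i p →
      (p : integralClosure ℤ_[p] K) ^ 2 ∣ f (p * i))
    -- `v_p(f_i) ≥ 2` for `i ∈ 𝕀(1,r−1)`, `v_p(f_r) = 2`, `v_p(f_i) ≥ 3` for `i ∈ 𝕀(r+1,p²−1)`
    (hR2a : ∀ i, 1 ≤ i → i ≤ r - 1 → Nat.Coprime i p →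
      (p : integralClosure ℤ_[p] K) ^ 2 ∣ f i)
    (hR2b : (p : integralClosure ℤ_[p] K) ^ 2 ∣ f r ∧
      ¬(p : integralClosure ℤ_[p] K) ^ 3 ∣ f r)
    (hR2c : ∀ i, r + 1 ≤ i → i ≤ p ^ 2 - 1 → Nat.Coprime i p →
      (p : integralClosure ℤ_[p] K) ^ 3 ∣ f i)
    -- `−F_p/F_{p²} ∈ (κ^×)^{p−1}`
    (h3 : ∃ c : κ, c ≠ 0 ∧ c ^ (p - 1) = -ρ a / ρ b)
    -- the extension `L = K(π)` generated by a root of `f`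
    (L : Type) [Field L] [Algebra K L] (π : L)
    (hπ : aeval π (X ^ p ^ 2 + ∑ i ∈ Finset.range (p ^ 2),
        C ((f (i + 1) : K)) * X ^ (p ^ 2 - (i + 1))) = 0)
    (hgen : adjoin K {π} = ⊤)
    -- `F` is the unique degree-`p` subextension, and it is Galois over `K`
    (F : IntermediateField K L) (hFdeg : Module.finrank K F = p)
    (hFuniq : ∀ F' : IntermediateField K L, Module.finrank K F' = p → F' = F)
    (hFgal : IsGalois K F) :
    IsGalois F L ↔
      ∃ c : κ, c ≠ 0 ∧ c ^ (p - 1) = (ℓ : κ) * ρ (g r) / (ρ a * ρ b) := by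
  have hp : p.Prime := Fact.out
  have : FiniteDimensional K L := by
    have hint : IsIntegral K π :=
      ⟨_, (monic_X_pow_add_sum (p ^ 2) fun i => (f i : K)).1, hπ⟩
    have := adjoin.finiteDimensional hint
    rw [hgen] at this
    exact topEquiv.toLinearEquiv.finiteDimensional
  let : Algebra ℚ_[p] L := ((algebraMap K L).comp (algebraMap ℚ_[p] K)).toAlgebra
  have : IsScalarTower ℚ_[p] K L := IsScalarTower.of_algebraMap_eq fun _ => rfl
  have : FiniteDimensional ℚ_[p] L := FiniteDimensional.trans ℚ_[p] K L
  have : IsScalarTower ℚ_[p] F L := IsScalarTower.of_algebraMap_eq fun _ => rfl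
  obtain ⟨N, rfl, hN, _, _⟩ := exists_normedField_norm_eq_spectralNorm ℚ_[p] L
  have hnorm : ∀ x : ℚ_[p], ‖algebraMap K L (algebraMap ℚ_[p] K x)‖ = ‖x‖ := fun x =>
    (hN _).trans (spectralNorm_extends x)
  have hpK : (p : K) ≠ 0 := by
    rw [← map_natCast (algebraMap ℚ_[p] K), _root_.map_ne_zero]
    exact_mod_cast hp.ne_zero
  have hpn : ‖(p : L)‖ = (p : ℝ)⁻¹ := by
    rw [← Padic.norm_p (p := p), ← hnorm, map_natCast, map_natCast]
  have hp1 : ‖(p : L)‖ < 1 := by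
    rw [hpn]
    exact inv_lt_one_of_one_lt₀ (by exact_mod_cast hp.one_lt)
  have hpL : (p : L) ≠ 0 := by
    rw [← map_natCast (algebraMap K L)]
    exact (_root_.map_ne_zero _).2 hpK
  have hj : ∀ o : integralClosure ℤ_[p] K,
      ‖algebraMap K L (algebraMap (integralClosure ℤ_[p] K) K o)‖ ≤ 1 :=
    norm_integralClosure_le_one hnorm
  have hfrac : ∀ x : K, ∃ d o : integralClosure ℤ_[p] K, algebraMap _ K d ≠ 0 ∧
      algebraMap _ K d * x = algebraMap _ K o := exists_integralClosure_mul_eq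
  have hloc : ∀ o : integralClosure ℤ_[p] K, ¬ (p : integralClosure ℤ_[p] K) ∣ o → IsUnit o :=
    fun o h => by_contra fun h' => h (hKloc o h')
  exact isGalois_iff_of_norm (q := p ^ 2) hp hodd rfl (algebraMap (integralClosure ℤ_[p] K) K) ρ hρ
    hker hpL hp1 hj (fun o h => norm_eq_one_of_isUnit hj (hloc o h))
    (fun x hx => exists_norm_eq_natCast_zpow hKloc hpK hp1 hj hfrac hx)
    (fun x hx => exists_eq_of_norm_le_one hKloc hpK hp1 hj hfrac hx)
    hℓ2 hℓp hr hfE hfE' ha hb hg hR1a hR2b.2 hR2c hπ hgen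
    (fun σ x => by
      rw [hN, hN, spectralNorm, spectralNorm]
      congr 1
      exact minpoly.algEquiv_eq (σ.restrictScalars ℚ_[p]) x)
    F hFdeg hFuniq
    (fun τ x => by
      rw [hN, hN, spectralNorm, spectralNorm, minpoly.algebraMap_eq (algebraMap F L).injective,
        minpoly.algebraMap_eq (algebraMap F L).injective]
      congr 1
      exact minpoly.algEquiv_eq (τ.restrictScalars ℚ_[p]) x)
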